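/- In the currency market setting, assume that adapted projections of elements of 𝓤 and 𝓨 remain in 𝓤 and 𝓨 respectively, that 𝓤 carries a barreled locally convex topology compatible with the pairing with 𝓨, that the parameterized objective is closed in u and the value function of (OCP) is proper, and that there is a convex normal integrand θ on ℝ^{(T+1)d}×Ω with Eθ finite on 𝓤, Eθ* proper on 𝓨, and V_T(Σ_{t=0}^T u_t, ω) ≤ θ(u,ω) for all u ∈ ℝ^{(T+1)d} and ω ∈ Ω. Then for any adapted u ∈ 𝓤∩𝓝, (z,k) ∈ 𝓝 solves (OCP) if and only if (z,k) is feasible and there exists a martingale y = (y_t)_{t=0}^T ∈ 𝓨 (y_t 𝓕_t-measurable, integrable, E[y_{t+1}|𝓕_t] = y_t for t < T) such that P-almost surely for every t = 0,…,T: −k_t ∈ ∂V_t*(y_t) and Δz_t + u_t + k_t ∈ ∂σ_{C_t}(y_t). -/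

import Mathlib

open MeasureTheory
open scoped ENNReal

noncomputable section

/-- The positive part of an extended real number, as an extended nonnegative real. -/
def epos (a : EReal) : ℝ≥0∞ := if a = ⊤ then ⊤ else ENNReal.ofReal a.toReal

/-- Expectation of an extended-real-valued function: `+∞` unless the positive part is
integrable. -/
def EE {Ω : Type} {mΩ : MeasurableSpace Ω} (P : Measure Ω) (φ : Ω → EReal) : EReal :=
  if ∫⁻ ω, epos (φ ω) ∂P = ⊤ then ⊤
  else ((∫⁻ ω, epos (φ ω) ∂P : ℝ≥0∞) : EReal) - ((∫⁻ ω, epos (-(φ ω)) ∂P : ℝ≥0∞) : EReal)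

/-- The scalar product on `ℝ^d`. -/
def dotd {d : ℕ} (a b : Fin d → ℝ) : ℝ := ∑ i, a i * b i

/-- The scalar product on `ℝ^{(T+1)d}`. -/
def dotB {T d : ℕ} (a b : Fin (T+1) → Fin d → ℝ) : ℝ := ∑ t, dotd (a t) (b t)

/-- `Δx_t = x_t − x_{t-1}` with the convention `x_{-1} := 0`. -/
def deltaX {T d : ℕ} (x : Fin (T+1) → Fin d → ℝ) (t : Fin (T+1)) : Fin d → ℝ :=
  x t - (if (t : ℕ) = 0 then 0 else
    x ⟨(t : ℕ) - 1, Nat.lt_of_le_of_lt (Nat.sub_le _ _) t.isLt⟩)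

/-- `Δy_{t+1} = y_{t+1} − y_t` with the convention `y_{T+1} := 0`. -/
def deltaNext {T d : ℕ} (y : Fin (T+1) → Fin d → ℝ) (t : Fin (T+1)) : Fin d → ℝ :=
  (if h : (t : ℕ) = T then 0 else
    y ⟨(t : ℕ) + 1, Nat.succ_lt_succ (Nat.lt_of_le_of_ne (Nat.lt_succ_iff.mp t.isLt) h)⟩) - y t

variable {Ω : Type} {mΩ : MeasurableSpace Ω} {T d : ℕ}

/-- The space `𝓝` of adapted processes. -/
def NBolza (d : ℕ) (ℱ : Fin (T+1) → MeasurableSpace Ω) :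
    Set (Ω → Fin (T+1) → Fin d → ℝ) :=
  {x | ∀ t, Measurable[ℱ t] (fun ω => x ω t)}

/-- The space `𝓝^∞` of essentially bounded adapted processes. -/
def NBolzaInf (d : ℕ) (ℱ : Fin (T+1) → MeasurableSpace Ω) (P : Measure Ω) :
    Set (Ω → Fin (T+1) → Fin d → ℝ) :=
  {x | x ∈ NBolza d ℱ ∧ ∃ M : ℝ, ∀ᵐ ω ∂P, ∀ t, ‖x ω t‖ ≤ M}

/-- The Bolza integrand `f(x,u,ω) = Σ_{t=0}^T K_t(x_t, Δx_t + u_t, ω)`. -/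
def fBolza (K : Fin (T+1) → (Fin d → ℝ) → (Fin d → ℝ) → Ω → EReal)
    (x u : Fin (T+1) → Fin d → ℝ) (ω : Ω) : EReal :=
  ∑ t, K t (x t) (deltaX x t + u t) ω

/-- `Ef(x,u)` for the Bolza problem. -/
def intFB (P : Measure Ω) (K : Fin (T+1) → (Fin d → ℝ) → (Fin d → ℝ) → Ω → EReal)
    (x u : Ω → Fin (T+1) → Fin d → ℝ) : EReal :=
  EE P fun ω => fBolza K (x ω) (u ω) ω

/-- The pairing `⟨u,y⟩ = E(u·y)`. -/
def pairB (P : Measure Ω) (u y : Ω → Fin (T+1) → Fin d → ℝ) : ℝ :=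
  ∫ ω, dotB (u ω) (y ω) ∂P

/-- The value function `φ(u) = inf_{x∈𝓝} Ef(x,u)`. -/
def phiB (P : Measure Ω) (K : Fin (T+1) → (Fin d → ℝ) → (Fin d → ℝ) → Ω → EReal)
    (ℱ : Fin (T+1) → MeasurableSpace Ω) (u : Ω → Fin (T+1) → Fin d → ℝ) : EReal :=
  ⨅ x ∈ NBolza d ℱ, intFB P K x u

/-- The auxiliary value function `φ̃(u) = inf_{x∈𝓝^∞} Ef(x,u)`. -/
def phiBInf (P : Measure Ω) (K : Fin (T+1) → (Fin d → ℝ) → (Fin d → ℝ) → Ω → EReal)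
    (ℱ : Fin (T+1) → MeasurableSpace Ω) (u : Ω → Fin (T+1) → Fin d → ℝ) : EReal :=
  ⨅ x ∈ NBolzaInf d ℱ P, intFB P K x u

/-- Conjugate on `𝓨` of a function on `𝓤`. -/
def conjB (P : Measure Ω) (𝓤 : Set (Ω → Fin (T+1) → Fin d → ℝ))
    (g : (Ω → Fin (T+1) → Fin d → ℝ) → EReal) (y : Ω → Fin (T+1) → Fin d → ℝ) : EReal :=
  ⨆ u ∈ 𝓤, (((pairB P u y : ℝ) : EReal) - g u)

/-- `K_t*(v,y,ω) = sup_{x,u} {x·v + u·y − K_t(x,u,ω)}`. -/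
def Kconj (K : Fin (T+1) → (Fin d → ℝ) → (Fin d → ℝ) → Ω → EReal) (t : Fin (T+1))
    (v y : Fin d → ℝ) (ω : Ω) : EReal :=
  ⨆ xx : Fin d → ℝ, ⨆ uu : Fin d → ℝ, (((dotd xx v + dotd uu y : ℝ) : EReal) - K t xx uu ω)

/-- The adapted projection `(ᵃu)_t = E_t u_t`. -/
def aProj (P : Measure Ω) (ℱ : Fin (T+1) → MeasurableSpace Ω)
    (u : Ω → Fin (T+1) → Fin d → ℝ) : Ω → Fin (T+1) → Fin d → ℝ :=
  fun ω t => (P[fun ω' => u ω' t | ℱ t]) ω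

/-- `E_t Δy_{t+1}`, the conditional expectation given `𝓕_t`. -/
def condDelta (P : Measure Ω) (ℱ : Fin (T+1) → MeasurableSpace Ω)
    (y : Ω → Fin (T+1) → Fin d → ℝ) (t : Fin (T+1)) : Ω → Fin d → ℝ :=
  P[fun ω => deltaNext (y ω) t | ℱ t]

/-- `dom₁ Ef`. -/
def dom1B (P : Measure Ω) (K : Fin (T+1) → (Fin d → ℝ) → (Fin d → ℝ) → Ω → EReal)
    (ℱ : Fin (T+1) → MeasurableSpace Ω) (𝓤 : Set (Ω → Fin (T+1) → Fin d → ℝ)) :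
    Set (Ω → Fin (T+1) → Fin d → ℝ) :=
  {x | x ∈ NBolza d ℱ ∧ ∃ u ∈ 𝓤, intFB P K x u < ⊤}

/-- Decomposability of a set of measurable functions. -/
def DecomposableB (P : Measure Ω) (S : Set (Ω → Fin (T+1) → Fin d → ℝ)) : Prop :=
  ∀ A : Set Ω, MeasurableSet A → ∀ u ∈ S, ∀ u' : Ω → Fin (T+1) → Fin d → ℝ,
    Measurable u' → (∃ M : ℝ, ∀ᵐ ω ∂P, ‖u' ω‖ ≤ M) →
    (fun ω => A.indicator u ω + Aᶜ.indicator u' ω) ∈ S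

/-- The weak topology `σ(𝓤,𝓨)` on `𝓤`. -/
def weakTopB (P : Measure Ω) (𝓤 𝓨 : Set (Ω → Fin (T+1) → Fin d → ℝ)) :
    TopologicalSpace {u // u ∈ 𝓤} :=
  TopologicalSpace.induced
    (fun u : {u // u ∈ 𝓤} => fun y : {y // y ∈ 𝓨} => pairB P u.1 y.1) Pi.topologicalSpace

/-- A function on `𝓤` is closed if it is `σ(𝓤,𝓨)`-lower semicontinuous and either proper
or constant. -/
def ClosedFnB (P : Measure Ω) (𝓤 𝓨 : Set (Ω → Fin (T+1) → Fin d → ℝ))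
    (g : (Ω → Fin (T+1) → Fin d → ℝ) → EReal) : Prop :=
  (@LowerSemicontinuous _ _ (weakTopB P 𝓤 𝓨) _ (fun u : {u // u ∈ 𝓤} => g u.1)) ∧
  (((∀ u ∈ 𝓤, g u ≠ ⊥) ∧ ∃ u ∈ 𝓤, g u ≠ ⊤) ∨ ∃ c : EReal, ∀ u ∈ 𝓤, g u = c)

/-- The space of adapted strategy pairs `(z,k)` of the currency market model. -/
def NOCP (d : ℕ) (ℱ : Fin (T+1) → MeasurableSpace Ω) :
    Set ((Ω → Fin (T+1) → Fin d → ℝ) × (Ω → Fin (T+1) → Fin d → ℝ)) :=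
  {x | (∀ t, Measurable[ℱ t] (fun ω => x.1 ω t)) ∧
       (∀ t, Measurable[ℱ t] (fun ω => x.2 ω t))}

open scoped Classical in
/-- The parameterized objective of (OCP):
`f((z,k),u,ω) = Σ_t [V_t(−k_t,ω) + δ_{C_t(ω)}(Δz_t + u_t + k_t)] + δ_{{0}}(z_T)`. -/
def fOCP (C : Fin (T+1) → Ω → Set (Fin d → ℝ))
    (V : Fin (T+1) → (Fin d → ℝ) → Ω → EReal)
    (z k u : Fin (T+1) → Fin d → ℝ) (ω : Ω) : EReal :=
  (∑ t, (V t (-(k t)) ω +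
    (if deltaX z t + u t + k t ∈ C t ω then (0 : EReal) else ⊤))) +
  (if z (Fin.last T) = 0 then (0 : EReal) else ⊤)

/-- `Ef((z,k),u)` for (OCP). -/
def intOCP (P : Measure Ω) (C : Fin (T+1) → Ω → Set (Fin d → ℝ))
    (V : Fin (T+1) → (Fin d → ℝ) → Ω → EReal)
    (x : (Ω → Fin (T+1) → Fin d → ℝ) × (Ω → Fin (T+1) → Fin d → ℝ))
    (u : Ω → Fin (T+1) → Fin d → ℝ) : EReal :=
  EE P fun ω => fOCP C V (x.1 ω) (x.2 ω) (u ω) ω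

/-- The value function of (OCP). -/
def phiOCP (P : Measure Ω) (C : Fin (T+1) → Ω → Set (Fin d → ℝ))
    (V : Fin (T+1) → (Fin d → ℝ) → Ω → EReal)
    (ℱ : Fin (T+1) → MeasurableSpace Ω) (u : Ω → Fin (T+1) → Fin d → ℝ) : EReal :=
  ⨅ x ∈ NOCP d ℱ, intOCP P C V x u

/-- `V_t*(y,ω) = sup_c {c·y − V_t(c,ω)}`. -/
def VconjOCP (V : Fin (T+1) → (Fin d → ℝ) → Ω → EReal) (t : Fin (T+1))
    (y : Fin d → ℝ) (ω : Ω) : EReal :=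
  ⨆ c : Fin d → ℝ, (((dotd c y : ℝ) : EReal) - V t c ω)

/-- The support function `σ_{C_t(ω)}(y)`. -/
def sigmaC (C : Fin (T+1) → Ω → Set (Fin d → ℝ)) (t : Fin (T+1)) (ω : Ω)
    (y : Fin d → ℝ) : EReal :=
  ⨆ c ∈ C t ω, ((dotd c y : ℝ) : EReal)

/-! ### Convex analysis -/

/-- Algebraic subgradient of a finite convex function. -/
lemma ocp_subgrad {E : Type*} [AddCommGroup E] [Module ℝ E] (h : E → ℝ)
    (hc : ∀ (a b : ℝ) (v w : E), 0 < a → 0 < b → a + b = 1 →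
      h (a • v + b • w) ≤ a * h v + b * h w) (u : E) :
    ∃ f : E →ₗ[ℝ] ℝ, ∀ v, h u + f v ≤ h (u + v) := by
  classical
  -- difference quotients
  set S : E → Set ℝ := fun v => {r | ∃ t : ℝ, 0 < t ∧ r = (h (u + t • v) - h u) / t} with hS
  have hne : ∀ v, (S v).Nonempty := fun v => ⟨_, 1, one_pos, rfl⟩
  have hlow : ∀ v, ∀ r ∈ S v, -(h (u - v) - h u) ≤ r := by
    rintro v r ⟨t, ht, rfl⟩
    have := hc (1 / (1 + t)) (t / (1 + t)) (u + t • v) (u - v) (by positivity) (by positivity)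
      (by field_simp)
    have e : (1 / (1 + t)) • (u + t • v) + (t / (1 + t)) • (u - v) = u := by
      have h1 : (1 + t) ≠ 0 := by positivity
      have : u = (1 / (1 + t) + t / (1 + t)) • u := by
        rw [show 1 / (1 + t) + t / (1 + t) = (1:ℝ) by field_simp, one_smul]
      conv_rhs => rw [this]
      module
    rw [e] at this
    rw [le_div_iff₀ ht]
    have h1 : 0 < 1 + t := by positivity
    have h2 : (1 + t) * h u ≤ h (u + t • v) + t * h (u - v) := by
      calc (1 + t) * h u ≤ (1 + t) * (1 / (1 + t) * h (u + t • v) + t / (1 + t) * h (u - v)) := by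
            gcongr
        _ = _ := by field_simp
    nlinarith
  have hbdd : ∀ v, BddBelow (S v) := fun v => ⟨_, fun r hr => hlow v r hr⟩
  set N : E → ℝ := fun v => sInf (S v) with hN
  have N_hom : ∀ c : ℝ, 0 < c → ∀ x, N (c • x) = c * N x := by
    have key : ∀ c : ℝ, 0 < c → ∀ x, c * N x ≤ N (c • x) := by
      intro c hc0 x
      apply le_csInf (hne _)
      rintro r ⟨t, ht, rfl⟩
      have : N x ≤ (h (u + (t * c) • x) - h u) / (t * c) :=
        csInf_le (hbdd x) ⟨t * c, by positivity, rfl⟩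
      calc c * N x ≤ c * ((h (u + (t * c) • x) - h u) / (t * c)) := by gcongr
        _ = _ := by rw [smul_smul]; field_simp
    intro c hc0 x
    apply le_antisymm _ (key c hc0 x)
    have := key c⁻¹ (by positivity) (c • x)
    rw [smul_smul, inv_mul_cancel₀ hc0.ne', one_smul] at this
    calc N (c • x) = c * (c⁻¹ * N (c • x)) := by field_simp
      _ ≤ _ := by gcongr
  have N_add : ∀ x y, N (x + y) ≤ N x + N y := by
    intro x y
    rw [← sub_le_iff_le_add']
    apply le_csInf (hne _)
    rintro r ⟨t, ht, rfl⟩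
    rw [sub_le_iff_le_add', ← sub_le_iff_le_add]
    apply le_csInf (hne _)
    rintro r ⟨s, hs, rfl⟩
    rw [sub_le_iff_le_add]
    have h1 : 0 < s + t := by positivity
    set m : ℝ := s * t / (s + t) with hm
    have hm0 : 0 < m := by positivity
    have h2 : N (x + y) ≤ (h (u + m • (x + y)) - h u) / m := csInf_le (hbdd _) ⟨m, hm0, rfl⟩
    refine h2.trans ?_
    have := hc (t / (s + t)) (s / (s + t)) (u + s • x) (u + t • y) (by positivity)
      (by positivity) (by field_simp; ring)
    have e : (t / (s + t)) • (u + s • x) + (s / (s + t)) • (u + t • y) = u + m • (x + y) := by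
      have : u = (t / (s + t) + s / (s + t)) • u := by
        rw [show t / (s + t) + s / (s + t) = (1:ℝ) by field_simp; ring, one_smul]
      conv_rhs => rw [this]
      rw [hm, show s * t / (s + t) = t / (s + t) * s by ring]
      rw [smul_add, smul_add, smul_add, smul_smul, smul_smul,
        show s / (s + t) * t = t / (s + t) * s by ring]
      module
    rw [e] at this
    rw [div_le_iff₀ hm0]
    calc h (u + m • (x + y)) - h u
        ≤ t / (s + t) * h (u + s • x) + s / (s + t) * h (u + t • y) - h u := by linarith
      _ = _ := by rw [hm]; field_simp; ring
  obtain ⟨f, -, hf⟩ := exists_extension_of_le_sublinear (⊥ : E →ₗ.[ℝ] ℝ) N N_hom N_add (by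
    rintro ⟨x, hx⟩
    have hx0 : x = 0 := (Submodule.mem_bot ℝ).1 hx
    subst hx0
    have h1 : (⊥ : E →ₗ.[ℝ] ℝ) ⟨0, hx⟩ = 0 := LinearPMap.map_zero _
    rw [h1]
    apply le_csInf (hne _)
    rintro r ⟨t, ht, rfl⟩
    simp)
  refine ⟨f, fun v => ?_⟩
  have h1 := hf v
  have h2 : N v ≤ (h (u + (1:ℝ) • v) - h u) / 1 := csInf_le (hbdd v) ⟨1, one_pos, rfl⟩
  rw [one_smul, div_one] at h2
  linarith

/-- A linear functional bounded above on a neighbourhood of the origin is continuous. -/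
lemma ocp_cont {E : Type*} [AddCommGroup E] [Module ℝ E] [TopologicalSpace E]
    [IsTopologicalAddGroup E] [ContinuousSMul ℝ E] (f : E →ₗ[ℝ] ℝ) (S : Set E)
    (hS : S ∈ nhds (0:E)) (M : ℝ) (hM : ∀ v ∈ S, f v ≤ M) : Continuous f := by
  apply continuous_of_continuousAt_zero f
  rw [ContinuousAt, map_zero, Metric.tendsto_nhds]
  intro ε hε
  set K : ℝ := |M| + 1 with hK
  have hK0 : 0 < K := by positivity
  set c : ℝ := K / ε * 2 with hcdef
  have hc0 : 0 < c := by positivity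
  have h1 : Filter.Tendsto (fun v : E => c • v) (nhds 0) (nhds 0) := by
    have : Continuous (fun v : E => c • v) := continuous_const_smul c
    simpa using this.tendsto 0
  have h2 : Filter.Tendsto (fun v : E => (-c) • v) (nhds 0) (nhds 0) := by
    have : Continuous (fun v : E => (-c) • v) := continuous_const_smul (-c)
    simpa using this.tendsto 0
  filter_upwards [h1 hS, h2 hS] with v hv1 hv2
  have a1 := hM _ hv1
  have a2 := hM _ hv2
  rw [map_smul, smul_eq_mul] at a1 a2
  have hMK : M < K := by rw [hK]; linarith [le_abs_self M]
  rw [Real.dist_eq, sub_zero, abs_lt]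
  have e : K = c * (ε / 2) := by rw [hcdef]; field_simp
  constructor
  · have : c * (-f v) < c * (ε / 2) := by nlinarith
    have := lt_of_mul_lt_mul_left this hc0.le
    linarith
  · have : c * (f v) < c * (ε / 2) := by nlinarith
    have := lt_of_mul_lt_mul_left this hc0.le
    linarith

lemma ocp_dotd_comm {d : ℕ} (a b : Fin d → ℝ) : dotd a b = dotd b a := by
  simp [dotd, mul_comm]

lemma ocp_dotd_sub_right {d : ℕ} (a b c : Fin d → ℝ) : dotd a (b - c) = dotd a b - dotd a c := by
  simp [dotd, mul_sub, Finset.sum_sub_distrib]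

lemma ocp_dotd_sub_left {d : ℕ} (a b c : Fin d → ℝ) : dotd (a - b) c = dotd a c - dotd b c := by
  simp [dotd, sub_mul, Finset.sum_sub_distrib]

lemma ocp_dotd_add_left {d : ℕ} (a b c : Fin d → ℝ) : dotd (a + b) c = dotd a c + dotd b c := by
  simp [dotd, add_mul, Finset.sum_add_distrib]

lemma ocp_dotd_neg_left {d : ℕ} (a c : Fin d → ℝ) : dotd (-a) c = - dotd a c := by
  simp [dotd]

lemma ocp_dotd_smul_left {d : ℕ} (s : ℝ) (a c : Fin d → ℝ) : dotd (s • a) c = s * dotd a c := by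
  simp [dotd, Finset.mul_sum, mul_assoc]

lemma ocp_dotd_zero_left {d : ℕ} (c : Fin d → ℝ) : dotd 0 c = 0 := by
  simp [dotd]

lemma ocp_dotd_cont {d : ℕ} (c : Fin d → ℝ) : Continuous (fun a : Fin d → ℝ => dotd a c) := by
  unfold dotd; fun_prop

/-- Fenchel duality at a point of the domain: a subgradient of the conjugate yields the
subgradient inequality for the function. -/
lemma ocp_fenchel {d : ℕ} (g : (Fin d → ℝ) → EReal)
    (hlsc : LowerSemicontinuous g)
    (hconv : ∀ (a b : ℝ) (c₁ c₂ : Fin d → ℝ), 0 < a → 0 < b → a + b = 1 →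
      g (a • c₁ + b • c₂) ≤ (a : EReal) * g c₁ + (b : EReal) * g c₂)
    (v0 y : Fin d → ℝ) (r : ℝ) (hr : g v0 = (r : EReal))
    (hsub : ∀ y' : Fin d → ℝ,
      (⨆ c : Fin d → ℝ, (((dotd c y : ℝ) : EReal) - g c)) + ((dotd v0 (y' - y) : ℝ) : EReal)
        ≤ ⨆ c : Fin d → ℝ, (((dotd c y' : ℝ) : EReal) - g c)) :
    ∀ v, ((r + dotd (v - v0) y : ℝ) : EReal) ≤ g v := by
  set epi : Set ((Fin d → ℝ) × ℝ) := {p | g p.1 ≤ (p.2 : EReal)} with hepi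
  have hcl : IsClosed epi := by
    have h1 := hlsc.isClosed_epigraph
    exact h1.preimage (f := fun p : (Fin d → ℝ) × ℝ => (p.1, (p.2 : EReal)))
      (continuous_fst.prodMk (continuous_coe_real_ereal.comp continuous_snd))
  have hcv : Convex ℝ epi := by
    rw [convex_iff_forall_pos]
    rintro ⟨v1, r1⟩ h1 ⟨v2, r2⟩ h2 a b ha hb hab
    have h1' : g v1 ≤ (r1 : EReal) := h1
    have h2' : g v2 ≤ (r2 : EReal) := h2
    show g (a • v1 + b • v2) ≤ ((a • r1 + b • r2 : ℝ) : EReal)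
    refine (hconv a b v1 v2 ha hb hab).trans ?_
    rw [smul_eq_mul, smul_eq_mul, EReal.coe_add, EReal.coe_mul, EReal.coe_mul]
    exact add_le_add (mul_le_mul_of_nonneg_left h1' (by exact_mod_cast ha.le))
      (mul_le_mul_of_nonneg_left h2' (by exact_mod_cast hb.le))
  -- the conjugate is bounded by affine minorants
  have key : ∀ s : ℝ, s < r → ∀ v (ρ : ℝ), g v ≤ (ρ : EReal) →
      s + dotd (v - v0) y ≤ ρ := by
    intro s hs v ρ hvρ
    have hnot : ((v0, s) : (Fin d → ℝ) × ℝ) ∉ epi := by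
      intro h
      have h' : g v0 ≤ (s : EReal) := h
      rw [hr] at h'
      exact absurd (EReal.coe_le_coe_iff.1 h') (not_le.2 hs)
    obtain ⟨f, γ, hf1, hf2⟩ := geometric_hahn_banach_point_closed hcv hcl hnot
    set l : ℝ := f (0, 1) with hl
    set p : Fin d → ℝ := fun i => f (Pi.single i 1, 0) with hp
    have hf : ∀ (w : Fin d → ℝ) (ρ : ℝ), f (w, ρ) = dotd w p + l * ρ := by
      intro w ρ
      have e1 : ((w, ρ) : (Fin d → ℝ) × ℝ) =
          (∑ i, w i • ((Pi.single i 1, 0) : (Fin d → ℝ) × ℝ)) + ρ • ((0, 1) : (Fin d → ℝ) × ℝ) := by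
        ext j
        · simp [Prod.fst_sum, Finset.sum_apply, Pi.single_apply]
        · simp [Prod.snd_sum]
      rw [e1, map_add, map_sum, map_smul]
      simp only [map_smul, smul_eq_mul, dotd, hp, hl]
      ring
    have hl0 : 0 < l := by
      have h1 := hf2 (v0, r) (by show g v0 ≤ _; rw [hr])
      rw [hf] at h1 hf1
      nlinarith
    set y' : Fin d → ℝ := (-(1 / l)) • p with hy'
    have hmin : ∀ w (ρ : ℝ), g w ≤ (ρ : EReal) → s + dotd (w - v0) y' ≤ ρ := by
      intro w ρ hw
      have h1 := hf2 (w, ρ) hw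
      rw [hf] at h1 hf1
      rw [ocp_dotd_comm, hy', ocp_dotd_smul_left, ocp_dotd_comm, ocp_dotd_sub_left]
      have h2 : l * (s + -(1 / l) * (dotd w p - dotd v0 p)) < l * ρ := by
        have : l * (s + -(1 / l) * (dotd w p - dotd v0 p)) = l * s - (dotd w p - dotd v0 p) := by
          field_simp; ring
        rw [this]; linarith
      exact (lt_of_mul_lt_mul_left h2 hl0.le).le
    have hconj : (⨆ c : Fin d → ℝ, (((dotd c y' : ℝ) : EReal) - g c)) ≤
        ((dotd v0 y' - s : ℝ) : EReal) := by
      apply iSup_le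
      intro c
      rcases eq_or_ne (g c) ⊤ with h | h
      · rw [h]; simp
      · apply EReal.sub_le_of_le_add
        rw [add_comm]
        have hle : ((s + dotd (c - v0) y' : ℝ) : EReal) ≤ g c := by
          apply EReal.le_of_forall_lt_iff_le.1
          intro z hz
          exact_mod_cast hmin c z hz.le
        calc ((dotd c y' : ℝ) : EReal)
            = ((s + dotd (c - v0) y' : ℝ) : EReal) + ((dotd v0 y' - s : ℝ) : EReal) := by
              rw [← EReal.coe_add, ocp_dotd_sub_left]; congr 1; ring
          _ ≤ _ := by gcongr
    have h3 := (hsub y').trans hconj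
    have h4 : ((dotd v y - ρ : ℝ) : EReal) ≤ ⨆ c : Fin d → ℝ, (((dotd c y : ℝ) : EReal) - g c) := by
      refine le_trans ?_ (le_iSup _ v)
      rw [EReal.coe_sub]
      exact EReal.sub_le_sub le_rfl hvρ
    have h5 : ((dotd v y - ρ : ℝ) : EReal) + ((dotd v0 (y' - y) : ℝ) : EReal)
        ≤ ((dotd v0 y' - s : ℝ) : EReal) := le_trans (by gcongr) h3
    have h6 : dotd v y - ρ + dotd v0 (y' - y) ≤ dotd v0 y' - s := by exact_mod_cast h5
    rw [ocp_dotd_sub_right] at h6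
    rw [ocp_dotd_sub_left]
    linarith
  intro v
  apply EReal.le_of_forall_lt_iff_le.1
  intro z hz
  rw [EReal.coe_le_coe_iff]
  apply le_of_forall_lt
  intro a ha
  have := key (r - (r + dotd (v - v0) y - a) / 2) (by linarith) v z hz.le
  linarith

/-! ### Measurable selections -/

lemma ocp_infDist_pt {Ω : Type} {m : MeasurableSpace Ω} {d : ℕ} (C : Ω → Set (Fin d → ℝ))
    (hC_meas : ∀ O : Set (Fin d → ℝ), IsOpen O → MeasurableSet {ω | (C ω ∩ O).Nonempty})
    (hC_ne : ∀ ω, (C ω).Nonempty) (v : Fin d → ℝ) :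
    Measurable (fun ω => Metric.infDist v (C ω)) := by
  apply measurable_of_Iio
  intro r
  convert hC_meas (Metric.ball v r) Metric.isOpen_ball using 1
  ext ω
  simp only [Set.mem_preimage, Set.mem_Iio, Set.mem_ofPred_eq]
  rw [Metric.infDist_lt_iff (hC_ne ω)]
  constructor
  · rintro ⟨y, hy, h⟩
    exact ⟨y, hy, by rwa [Metric.mem_ball, dist_comm]⟩
  · rintro ⟨y, hy, h⟩
    exact ⟨y, hy, by rwa [Metric.mem_ball, dist_comm] at h⟩

lemma ocp_infDist_meas {Ω : Type} {m : MeasurableSpace Ω} {d : ℕ} (C : Ω → Set (Fin d → ℝ))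
    (hC_meas : ∀ O : Set (Fin d → ℝ), IsOpen O → MeasurableSet {ω | (C ω ∩ O).Nonempty})
    (hC_ne : ∀ ω, (C ω).Nonempty) :
    Measurable (fun p : (Fin d → ℝ) × Ω => Metric.infDist p.1 (C p.2)) := by
  apply measurable_uncurry_of_continuous_of_measurable
    (u := fun (v : Fin d → ℝ) (ω : Ω) => Metric.infDist v (C ω))
  · intro ω
    exact Metric.continuous_infDist_pt _
  · intro v
    exact ocp_infDist_pt C hC_meas hC_ne v

lemma ocp_mem_meas {Ω : Type} {m : MeasurableSpace Ω} {d : ℕ} (C : Ω → Set (Fin d → ℝ))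
    (hC_meas : ∀ O : Set (Fin d → ℝ), IsOpen O → MeasurableSet {ω | (C ω ∩ O).Nonempty})
    (hC_closed : ∀ ω, IsClosed (C ω)) (hC_ne : ∀ ω, (C ω).Nonempty)
    (c : Ω → Fin d → ℝ) (hc : Measurable c) :
    MeasurableSet {ω | c ω ∈ C ω} := by
  have h1 := (ocp_infDist_meas C hC_meas hC_ne).comp (hc.prodMk measurable_id)
  convert h1 (measurableSet_singleton 0) using 1
  ext ω
  simp only [Set.mem_ofPred_eq, Set.mem_preimage, Set.mem_singleton_iff, Function.comp, id]
  exact (hC_closed ω).mem_iff_infDist_zero (hC_ne ω)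

lemma ocp_sel_step {Ω : Type} {m : MeasurableSpace Ω} {d : ℕ} (C : Ω → Set (Fin d → ℝ))
    (hC_meas : ∀ O : Set (Fin d → ℝ), IsOpen O → MeasurableSet {ω | (C ω ∩ O).Nonempty})
    (hC_ne : ∀ ω, (C ω).Nonempty)
    (p : Ω → Fin d → ℝ) (hp : Measurable p) (r : ℝ) (hr : ∀ ω, Metric.infDist (p ω) (C ω) < r) :
    ∃ p' : Ω → Fin d → ℝ, Measurable p' ∧ (∀ ω, Metric.infDist (p' ω) (C ω) < r / 2) ∧
      ∀ ω, dist (p ω) (p' ω) < r := by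
  classical
  set e : ℕ → Fin d → ℝ := TopologicalSpace.denseSeq (Fin d → ℝ) with he
  have hex : ∀ ω, ∃ j, Metric.infDist (e j) (C ω) < r / 2 ∧ dist (p ω) (e j) < r := by
    intro ω
    obtain ⟨c, hc, hcd⟩ := (Metric.infDist_lt_iff (hC_ne ω)).1 (hr ω)
    have hr0 : 0 < r := lt_of_le_of_lt dist_nonneg hcd
    obtain ⟨j, hj⟩ := (TopologicalSpace.denseRange_denseSeq (Fin d → ℝ)).exists_dist_lt c
      (ε := min (r / 2) (r - dist (p ω) c)) (by apply lt_min <;> linarith)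
    refine ⟨j, ?_, ?_⟩
    · refine (Metric.infDist_lt_iff (hC_ne ω)).2 ⟨c, hc, ?_⟩
      rw [dist_comm]
      exact lt_of_lt_of_le hj (min_le_left _ _)
    · have := lt_of_lt_of_le hj (min_le_right _ _)
      have h2 := dist_triangle (p ω) c (e j)
      change dist c (e j) < _ at this
      linarith
  refine ⟨fun ω => e (Nat.find (hex ω)), ?_, ?_, ?_⟩
  · refine (measurable_from_nat (f := e)).comp (measurable_find hex ?_)
    intro k
    refine MeasurableSet.inter ?_ ?_
    · exact measurableSet_lt (ocp_infDist_pt C hC_meas hC_ne (e k)) measurable_const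
    · exact measurableSet_lt (hp.dist measurable_const) measurable_const
  · intro ω; exact (Nat.find_spec (hex ω)).1
  · intro ω; exact (Nat.find_spec (hex ω)).2

lemma ocp_sel {Ω : Type} {m : MeasurableSpace Ω} {d : ℕ} (C : Ω → Set (Fin d → ℝ))
    (hC_meas : ∀ O : Set (Fin d → ℝ), IsOpen O → MeasurableSet {ω | (C ω ∩ O).Nonempty})
    (hC_closed : ∀ ω, IsClosed (C ω)) (hC_ne : ∀ ω, (C ω).Nonempty)
    (p0 : Ω → Fin d → ℝ) (hp0 : Measurable p0) (r : ℝ)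
    (hr : ∀ ω, Metric.infDist (p0 ω) (C ω) < r) :
    ∃ p : Ω → Fin d → ℝ, Measurable p ∧ (∀ ω, p ω ∈ C ω) ∧ ∀ ω, dist (p0 ω) (p ω) ≤ 2 * r := by
  classical
  have step : ∀ (n : ℕ) (q : {q : Ω → Fin d → ℝ // Measurable q ∧
      ∀ ω, Metric.infDist (q ω) (C ω) < r / 2 ^ n}),
      ∃ q' : {q : Ω → Fin d → ℝ // Measurable q ∧
        ∀ ω, Metric.infDist (q ω) (C ω) < r / 2 ^ (n + 1)},
        ∀ ω, dist (q.1 ω) (q'.1 ω) < r / 2 ^ n := by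
    intro n q
    obtain ⟨q', h1, h2, h3⟩ := ocp_sel_step C hC_meas hC_ne q.1 q.2.1 _ q.2.2
    refine ⟨⟨q', h1, fun ω => ?_⟩, h3⟩
    have := h2 ω
    rwa [div_div, ← pow_succ] at this
  choose nx hnx using step
  let s : ∀ n : ℕ, {q : Ω → Fin d → ℝ // Measurable q ∧
      ∀ ω, Metric.infDist (q ω) (C ω) < r / 2 ^ n} :=
    fun n => Nat.rec ⟨p0, hp0, by simpa using hr⟩ (fun n q => nx n q) n
  have hs0 : (s 0).1 = p0 := rfl
  have hs : ∀ n ω, dist ((s n).1 ω) ((s (n + 1)).1 ω) ≤ (2 * r) / 2 / 2 ^ n := by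
    intro n ω
    have := (hnx n (s n) ω).le
    calc _ ≤ r / 2 ^ n := this
      _ = _ := by ring
  have hlim : ∀ ω, ∃ a, Filter.Tendsto (fun n => (s n).1 ω) Filter.atTop (nhds a) := fun ω =>
    cauchySeq_tendsto_of_complete (cauchySeq_of_le_geometric_two (fun n => hs n ω))
  choose p hp using hlim
  refine ⟨p, ?_, ?_, ?_⟩
  · exact measurable_of_tendsto_metrizable (fun n => (s n).2.1) (tendsto_pi_nhds.2 hp)
  · intro ω
    rw [(hC_closed ω).mem_iff_infDist_zero (hC_ne ω)]
    apply le_antisymm _ Metric.infDist_nonneg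
    have h1 : Filter.Tendsto (fun n => Metric.infDist ((s n).1 ω) (C ω)) Filter.atTop
        (nhds (Metric.infDist (p ω) (C ω))) :=
      ((Metric.continuous_infDist_pt (C ω)).tendsto _).comp (hp ω)
    have h2 : Filter.Tendsto (fun n : ℕ => r / 2 ^ n) Filter.atTop (nhds 0) :=
      tendsto_const_nhds.div_atTop (tendsto_pow_atTop_atTop_of_one_lt (by norm_num))
    exact le_of_tendsto_of_tendsto' h1 h2 (fun n => ((s n).2.2 ω).le)
  · intro ω
    exact dist_le_of_le_geometric_two_of_tendsto₀ (fun n => hs n ω) (hp ω)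

/-- A countable family of measurable selections which is pointwise dense. -/
lemma ocp_castaing {Ω : Type} {m : MeasurableSpace Ω} {d : ℕ} (C : Ω → Set (Fin d → ℝ))
    (hC_meas : ∀ O : Set (Fin d → ℝ), IsOpen O → MeasurableSet {ω | (C ω ∩ O).Nonempty})
    (hC_closed : ∀ ω, IsClosed (C ω)) (hC_zero : ∀ ω, (0 : Fin d → ℝ) ∈ C ω) :
    ∃ p : ℕ → ℕ → Ω → Fin d → ℝ, (∀ i j, Measurable (p i j)) ∧ (∀ i j ω, p i j ω ∈ C ω) ∧
      ∀ ω, ∀ c ∈ C ω, ∀ ε > 0, ∃ i j, dist (p i j ω) c < ε := by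
  classical
  have hne : ∀ ω, (C ω).Nonempty := fun ω => ⟨0, hC_zero ω⟩
  obtain ⟨e, hde⟩ : ∃ e : ℕ → Fin d → ℝ, DenseRange e :=
    ⟨_, TopologicalSpace.denseRange_denseSeq (Fin d → ℝ)⟩
  have h : ∀ i j : ℕ, ∃ p : Ω → Fin d → ℝ, Measurable p ∧ (∀ ω, p ω ∈ C ω) ∧
      ∀ ω, Metric.infDist (e i) (C ω) < 1 / ((j : ℝ) + 1) →
        dist (e i) (p ω) ≤ 2 * (1 / ((j : ℝ) + 1)) := by
    intro i j
    have hr : (0:ℝ) < 1 / ((j : ℝ) + 1) := by positivity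
    have hB : MeasurableSet {ω | Metric.infDist (e i) (C ω) < 1 / ((j : ℝ) + 1)} := by
      have hmm : Measurable (fun ω => Metric.infDist (e i) (C ω)) :=
        ocp_infDist_pt C hC_meas hne (e i)
      exact measurableSet_lt hmm measurable_const
    set B : Set Ω := {ω | Metric.infDist (e i) (C ω) < 1 / ((j : ℝ) + 1)} with hBdef
    obtain ⟨p, h1, h2, h3⟩ := ocp_sel C hC_meas hC_closed hne
      (B.indicator (fun _ => e i))
      (measurable_const.indicator hB) (1 / ((j : ℝ) + 1)) (by
        intro ω
        by_cases h : ω ∈ B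
        · rw [Set.indicator_of_mem h]; exact h
        · rw [Set.indicator_of_notMem h, Metric.infDist_zero_of_mem (hC_zero ω)]; exact hr)
    refine ⟨p, h1, h2, fun ω hω => ?_⟩
    have := h3 ω
    rwa [Set.indicator_of_mem (show ω ∈ B from hω)] at this
  choose p h1 h2 h3 using h
  refine ⟨p, h1, h2, fun ω c hc ε hε => ?_⟩
  obtain ⟨j, hj⟩ := exists_nat_one_div_lt (show (0:ℝ) < ε / 3 by positivity)
  obtain ⟨i, hi⟩ := hde.exists_dist_lt c
    (ε := 1 / ((j : ℝ) + 1)) (by positivity)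
  refine ⟨i, j, ?_⟩
  have h4 := h3 i j ω ((Metric.infDist_lt_iff (hne ω)).2 ⟨c, hc, by rwa [dist_comm]⟩)
  have h5 := dist_triangle_left (p i j ω) c (e i)
  rw [dist_comm] at hi
  linarith

/-! ### Conditional expectations -/

lemma ocp_onestep {Ω : Type} {m mΩ : MeasurableSpace Ω} (P : Measure Ω) [IsProbabilityMeasure P]
    (hm : m ≤ mΩ) {ι : Type} (s : Finset ι) (a b : ι → Ω → ℝ)
    (ha : ∀ j ∈ s, Measurable[m] (a j)) (hb : ∀ j ∈ s, Integrable (b j) P)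
    (H : Ω → ℝ) (hH : Integrable H P) (hle : ∀ᵐ ω ∂P, ∑ j ∈ s, a j ω * b j ω ≤ H ω) :
    ∀ᵐ ω ∂P, ∑ j ∈ s, a j ω * (P[b j | m]) ω ≤ (P[H | m]) ω := by
  classical
  have main : ∀ N : ℕ, ∀ᵐ ω ∂P, (∀ j ∈ s, |a j ω| ≤ N) →
      ∑ j ∈ s, a j ω * (P[b j | m]) ω ≤ (P[H | m]) ω := by
    intro N
    set B : Set Ω := {ω | ∀ j ∈ s, |a j ω| ≤ N} with hB
    have hBm : MeasurableSet[m] B := by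
      have : B = ⋂ j ∈ s, {ω | |a j ω| ≤ N} := by ext; simp [hB]
      rw [this]
      refine Finset.measurableSet_biInter s (fun j hj => ?_)
      have h1 : Measurable[m] (fun ω => |a j ω|) := continuous_abs.measurable.comp (ha j hj)
      exact h1 (measurableSet_Iic (a := (N : ℝ)))
    set χ : Ω → ℝ := B.indicator (fun _ => 1) with hχ
    have hχm : Measurable[m] χ := Measurable.indicator (@measurable_const _ _ _ m _) hBm
    have hχ1 : ∀ ω, |χ ω| ≤ 1 := by
      intro ω; by_cases h : ω ∈ B <;> simp [hχ, h]
    have hχa : ∀ j ∈ s, ∀ ω, |(χ * a j) ω| ≤ N := by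
      intro j hj ω
      by_cases h : ω ∈ B
      · simpa [hχ, h] using h j hj
      · simp [hχ, h]
    have hcam : ∀ j ∈ s, Measurable[m] (χ * a j) := fun j hj => hχm.mul (ha j hj)
    have hint : ∀ j ∈ s, Integrable ((χ * a j) * b j) P := by
      intro j hj
      refine (hb j hj).bdd_mul (c := N) ((hcam j hj).mono hm le_rfl).aestronglyMeasurable
        (Filter.Eventually.of_forall (fun ω => hχa j hj ω))
    have hintH : Integrable (χ * H) P :=
      hH.bdd_mul (c := 1) (hχm.mono hm le_rfl).aestronglyMeasurable
        (Filter.Eventually.of_forall hχ1)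
    have hmono : (∑ j ∈ s, (χ * a j) * b j) ≤ᵐ[P] χ * H := by
      filter_upwards [hle] with ω hω
      simp only [Finset.sum_apply, Pi.mul_apply]
      by_cases h : ω ∈ B
      · simpa [hχ, h] using hω
      · simp [hχ, h]
    have h1 := condExp_mono (m := m) (integrable_finsetSum' s hint) hintH hmono
    have h2 := condExp_finsetSum hint m
    have h3 := condExp_mul_of_stronglyMeasurable_left hχm.stronglyMeasurable hintH hH
    have h4 : ∀ᵐ ω ∂P, ∀ j ∈ s, (P[(χ * a j) * b j | m]) ω = ((χ * a j) * P[b j | m]) ω := by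
      rw [Filter.eventually_all_finset]
      intro j hj
      exact condExp_mul_of_stronglyMeasurable_left (hcam j hj).stronglyMeasurable (hint j hj)
        (hb j hj)
    filter_upwards [h1, h2, h3, h4] with ω w1 w2 w3 w4 hω
    rw [w2, w3] at w1
    have hωB : ω ∈ B := hω
    rw [Finset.sum_apply, Finset.sum_congr rfl w4] at w1
    simpa [hχ, hωB] using w1
  rw [← ae_all_iff] at main
  filter_upwards [main] with ω hω
  obtain ⟨N, hN⟩ := exists_nat_ge (∑ j ∈ s, |a j ω|)
  refine hω N (fun j hj => le_trans ?_ hN)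
  exact Finset.single_le_sum (f := fun j => |a j ω|) (fun i _ => abs_nonneg _) hj

/-- A martingale transform dominated by an integrable `H` forces `E H ≥ 0`. -/
lemma ocp_key {Ω : Type} {mΩ : MeasurableSpace Ω} (P : Measure Ω) [IsProbabilityMeasure P]
    {T d : ℕ} (ℱ : Fin (T+1) → MeasurableSpace Ω)
    (hℱ_le : ∀ t, ℱ t ≤ mΩ) (hℱ_mono : Monotone ℱ)
    (a : Fin (T+1) × Fin d → Ω → ℝ) (ha : ∀ j, Measurable[ℱ j.1] (a j)) :
    ∀ n : ℕ, n ≤ T + 1 → ∀ (w : Fin (T+1) × Fin d → Ω → ℝ), (∀ j, Integrable (w j) P) →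
      (∀ j, (j.1 : ℕ) < n → P[w j | ℱ j.1] =ᵐ[P] 0) → ∀ H : Ω → ℝ, Integrable H P →
      (∀ᵐ ω ∂P, ∑ j ∈ Finset.univ.filter (fun j : Fin (T+1) × Fin d => (j.1 : ℕ) < n),
        a j ω * w j ω ≤ H ω) → 0 ≤ ∫ ω, H ω ∂P := by
  classical
  intro n
  induction n with
  | zero =>
    intro _ w _ _ H hH hle
    apply integral_nonneg_of_ae
    filter_upwards [hle] with ω hω
    simpa using hω
  | succ n ih =>
    intro hn w hw hw0 H hH hle
    set τ : Fin (T+1) := ⟨n, hn⟩ with hτ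
    rw [← integral_condExp (hℱ_le τ)]
    refine ih (by omega) (fun j => P[w j | ℱ τ]) (fun j => integrable_condExp) ?_ _
      integrable_condExp ?_
    · intro j hj
      have hjτ : j.1 ≤ τ := by rw [Fin.le_def]; exact hj.le
      exact (condExp_condExp_of_le (hℱ_mono hjτ) (hℱ_le τ)).trans (hw0 j (by omega))
    · have h1 := ocp_onestep P (hℱ_le τ)
        (Finset.univ.filter (fun j : Fin (T+1) × Fin d => (j.1 : ℕ) < n + 1)) a w
        (by
          intro j hj
          have hj' : (j.1 : ℕ) < n + 1 := (Finset.mem_filter.1 hj).2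
          have hjτ : j.1 ≤ τ := by rw [Fin.le_def]; exact Nat.lt_succ_iff.1 hj'
          exact (ha j).mono (hℱ_mono hjτ) le_rfl) (fun j _ => hw j) H hH hle
      have h2 : ∀ᵐ ω ∂P, ∀ j : Fin (T+1) × Fin d, (j.1 : ℕ) = n → (P[w j | ℱ τ]) ω = 0 := by
        rw [ae_all_iff]
        intro j
        by_cases hj : (j.1 : ℕ) = n
        · have : j.1 = τ := Fin.ext hj
          filter_upwards [hw0 j (by omega)] with ω hω _
          rw [this] at hω
          exact hω
        · exact Filter.Eventually.of_forall (fun ω h => absurd h hj)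
      filter_upwards [h1, h2] with ω w1 w2
      refine le_trans (le_of_eq ?_) w1
      apply Finset.sum_subset
      · intro j hj
        simp only [Finset.mem_filter, Finset.mem_univ, true_and] at hj ⊢
        omega
      · intro j hj hj'
        simp only [Finset.mem_filter, Finset.mem_univ, true_and] at hj hj'
        rw [w2 j (by omega), mul_zero]

/-! ### Expectations of extended-real-valued functions -/

lemma ocp_epos_eq (a : EReal) : epos a = a.toENNReal := rfl

lemma ocp_epos_mono {a b : EReal} (h : a ≤ b) : epos a ≤ epos b :=
  EReal.toENNReal_le_toENNReal h

lemma ocp_EE_mono {Ω : Type} {mΩ : MeasurableSpace Ω} (P : Measure Ω) (f g : Ω → EReal)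
    (h : ∀ᵐ ω ∂P, f ω ≤ g ω) : EE P f ≤ EE P g := by
  have h1 : ∫⁻ ω, epos (f ω) ∂P ≤ ∫⁻ ω, epos (g ω) ∂P :=
    lintegral_mono_ae (h.mono fun ω hω => ocp_epos_mono hω)
  have h2 : ∫⁻ ω, epos (-(g ω)) ∂P ≤ ∫⁻ ω, epos (-(f ω)) ∂P :=
    lintegral_mono_ae (h.mono fun ω hω => ocp_epos_mono (EReal.neg_le_neg_iff.2 hω))
  unfold EE
  by_cases hg : ∫⁻ ω, epos (g ω) ∂P = ⊤
  · rw [if_pos hg]; exact le_top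
  · rw [if_neg hg, if_neg (fun hf : ∫⁻ ω, epos (f ω) ∂P = ⊤ => hg (top_le_iff.1 (by rw [← hf]; exact h1)))]
    exact EReal.sub_le_sub (by exact_mod_cast h1) (by exact_mod_cast h2)

lemma ocp_EE_congr {Ω : Type} {mΩ : MeasurableSpace Ω} (P : Measure Ω) (f g : Ω → EReal)
    (h : ∀ᵐ ω ∂P, f ω = g ω) : EE P f = EE P g :=
  le_antisymm (ocp_EE_mono P f g (h.mono fun _ h => h.le))
    (ocp_EE_mono P g f (h.mono fun _ h => h.ge))

lemma ocp_EE_real {Ω : Type} {mΩ : MeasurableSpace Ω} (P : Measure Ω) (F : Ω → ℝ)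
    (hF : Integrable F P) : EE P (fun ω => (F ω : EReal)) = ((∫ ω, F ω ∂P : ℝ) : EReal) := by
  have e1 : ∀ ω, epos (F ω : EReal) = ENNReal.ofReal (F ω) := fun ω => rfl
  have e2 : ∀ ω, epos (-(F ω : EReal)) = ENNReal.ofReal (-F ω) := fun ω => rfl
  have f1 : ∫⁻ ω, ENNReal.ofReal (F ω) ∂P ≠ ⊤ := hF.lintegral_lt_top.ne
  have f2 : ∫⁻ ω, ENNReal.ofReal (-F ω) ∂P ≠ ⊤ := hF.neg.lintegral_lt_top.ne
  unfold EE
  simp only [e1, e2]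
  rw [if_neg f1, integral_eq_lintegral_pos_part_sub_lintegral_neg_part hF, EReal.coe_sub]
  rw [← EReal.coe_toReal (x := ((∫⁻ ω, ENNReal.ofReal (F ω) ∂P : ℝ≥0∞) : EReal)) (by simpa using f1)
    (by simp), ← EReal.coe_toReal
    (x := ((∫⁻ ω, ENNReal.ofReal (-F ω) ∂P : ℝ≥0∞) : EReal)) (by simpa using f2)
    (by simp)]
  simp

lemma ocp_EE_fin {Ω : Type} {mΩ : MeasurableSpace Ω} (P : Measure Ω) (f : Ω → EReal)
    (hf : Measurable f) (h1 : EE P f ≠ ⊤) (h2 : EE P f ≠ ⊥) :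
    ∃ F : Ω → ℝ, Integrable F P ∧ (∀ᵐ ω ∂P, f ω = (F ω : EReal)) ∧
      EE P f = ((∫ ω, F ω ∂P : ℝ) : EReal) := by
  have hA : ∫⁻ ω, epos (f ω) ∂P ≠ ⊤ := by
    intro h; apply h1; unfold EE; rw [if_pos h]
  have hB : ∫⁻ ω, epos (-(f ω)) ∂P ≠ ⊤ := by
    intro h; apply h2; unfold EE; rw [if_neg hA, h]
    rw [← EReal.coe_toReal (x := ((∫⁻ ω, epos (f ω) ∂P : ℝ≥0∞) : EReal)) (by simpa using hA)
    (by simp)]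
    simp
  have m1 : Measurable (fun ω => epos (f ω)) := hf.ereal_toENNReal
  have m2 : Measurable (fun ω => epos (-(f ω))) :=
    Measurable.ereal_toENNReal (continuous_neg.measurable.comp hf)
  have t1 := ae_lt_top m1 hA
  have t2 := ae_lt_top m2 hB
  have hae : ∀ᵐ ω ∂P, f ω = (((f ω).toReal : ℝ) : EReal) := by
    filter_upwards [t1, t2] with ω w1 w2
    rw [ocp_epos_eq] at w1 w2
    refine (EReal.coe_toReal ?_ ?_).symm
    · exact EReal.toENNReal_ne_top_iff.1 w1.ne
    · intro h
      have := EReal.toENNReal_ne_top_iff.1 w2.ne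
      rw [h] at this
      simp at this
  have hint : Integrable (fun ω => (f ω).toReal) P := by
    refine ⟨hf.ereal_toReal.aestronglyMeasurable, ?_⟩
    have : ∫⁻ ω, (epos (f ω) + epos (-(f ω))) ∂P < ⊤ := by
      rw [lintegral_add_left m1]
      exact ENNReal.add_lt_top.2 ⟨hA.lt_top, hB.lt_top⟩
    refine lt_of_le_of_lt (lintegral_mono_ae ?_) this
    filter_upwards [hae] with ω hω
    generalize (f ω).toReal = r at hω
    rw [hω]
    change ‖r‖ₑ ≤ ENNReal.ofReal r + ENNReal.ofReal (-r)
    rw [← ofReal_norm, Real.norm_eq_abs]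
    rcases le_total 0 r with h | h
    · rw [abs_of_nonneg h]; exact le_self_add
    · rw [abs_of_nonpos h]; exact le_add_self
  refine ⟨fun ω => (f ω).toReal, hint, hae, ?_⟩
  rw [ocp_EE_congr P _ _ hae, ocp_EE_real P _ hint]

/-! ### Sums of extended reals -/

lemma ocp_coe_sum {ι : Type} (s : Finset ι) (r : ι → ℝ) :
    ((∑ i ∈ s, r i : ℝ) : EReal) = ∑ i ∈ s, (r i : EReal) := by
  classical
  induction s using Finset.induction_on with
  | empty => simp
  | insert a s ha ih => rw [Finset.sum_insert ha, Finset.sum_insert ha, EReal.coe_add, ih]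

lemma ocp_sum_ne_bot {ι : Type} (s : Finset ι) (r : ι → EReal) (h : ∀ i ∈ s, r i ≠ ⊥) :
    ∑ i ∈ s, r i ≠ ⊥ := by
  classical
  induction s using Finset.induction_on with
  | empty => simp
  | insert a s ha ih =>
    rw [Finset.sum_insert ha]
    exact EReal.add_ne_bot_iff.2 ⟨h a (by simp), ih (fun i hi => h i (by simp [hi]))⟩

lemma ocp_sum_ne_top {ι : Type} (s : Finset ι) (r : ι → EReal) (h : ∀ i ∈ s, r i ≠ ⊥)
    (hs : ∑ i ∈ s, r i ≠ ⊤) : ∀ i ∈ s, r i ≠ ⊤ := by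
  classical
  intro i hi h0
  apply hs
  rw [← Finset.add_sum_erase s r hi, h0]
  exact EReal.top_add_of_ne_bot (ocp_sum_ne_bot _ _ (fun j hj => h j (Finset.mem_of_mem_erase hj)))

/-! ### The objective -/

lemma ocp_f_of {Ω : Type} {T d : ℕ} (C : Fin (T+1) → Ω → Set (Fin d → ℝ))
    (V : Fin (T+1) → (Fin d → ℝ) → Ω → EReal) (z k u : Fin (T+1) → Fin d → ℝ) (ω : Ω)
    (h1 : ∀ t, deltaX z t + u t + k t ∈ C t ω) (h2 : z (Fin.last T) = 0) :
    fOCP C V z k u ω = ∑ t, V t (-(k t)) ω := by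
  unfold fOCP
  rw [if_pos h2, add_zero]
  exact Finset.sum_congr rfl (fun t _ => by rw [if_pos (h1 t), add_zero])

lemma ocp_f_fin {Ω : Type} {T d : ℕ} (C : Fin (T+1) → Ω → Set (Fin d → ℝ))
    (V : Fin (T+1) → (Fin d → ℝ) → Ω → EReal) (z k u : Fin (T+1) → Fin d → ℝ) (ω : Ω)
    (hV : ∀ t c, V t c ω ≠ ⊥) (F : ℝ) (hF : fOCP C V z k u ω = (F : EReal)) :
    (∀ t, deltaX z t + u t + k t ∈ C t ω) ∧ z (Fin.last T) = 0 ∧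
    (∀ t, V t (-(k t)) ω = (((V t (-(k t)) ω).toReal : ℝ) : EReal)) ∧
      F = ∑ t, (V t (-(k t)) ω).toReal := by
  classical
  have hnb : ∀ t ∈ (Finset.univ : Finset (Fin (T+1))), (V t (-(k t)) ω +
      (if deltaX z t + u t + k t ∈ C t ω then (0 : EReal) else ⊤)) ≠ ⊥ := by
    intro t _
    refine EReal.add_ne_bot_iff.2 ⟨hV _ _, ?_⟩
    split_ifs <;> simp
  have hz : z (Fin.last T) = 0 := by
    by_contra h
    unfold fOCP at hF
    rw [if_neg h, EReal.add_top_of_ne_bot (ocp_sum_ne_bot _ _ hnb)] at hF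
    exact EReal.coe_ne_top _ hF.symm
  have hnt := ocp_sum_ne_top Finset.univ _ hnb (by
    unfold fOCP at hF
    rw [if_pos hz, add_zero] at hF
    rw [hF]; exact EReal.coe_ne_top _)
  have hmem : ∀ t, deltaX z t + u t + k t ∈ C t ω := by
    intro t
    by_contra h
    have := hnt t (Finset.mem_univ t)
    rw [if_neg h, EReal.add_top_of_ne_bot (hV _ _)] at this
    exact this rfl
  have hVr : ∀ t, V t (-(k t)) ω = (((V t (-(k t)) ω).toReal : ℝ) : EReal) := by
    intro t
    have := hnt t (Finset.mem_univ t)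
    rw [if_pos (hmem t), add_zero] at this
    exact (EReal.coe_toReal this (hV _ _)).symm
  refine ⟨hmem, hz, hVr, ?_⟩
  rw [ocp_f_of C V z k u ω hmem hz, Finset.sum_congr rfl (fun t _ => hVr t), ← ocp_coe_sum] at hF
  exact (EReal.coe_injective hF).symm

lemma ocp_deltaX_lin {T d : ℕ} (a b : ℝ) (x y : Fin (T+1) → Fin d → ℝ) (t : Fin (T+1)) :
    deltaX (a • x + b • y) t = a • deltaX x t + b • deltaX y t := by
  unfold deltaX
  split_ifs with h
  · simp
  · simp only [Pi.add_apply, Pi.smul_apply]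
    module

lemma ocp_deltaX_meas {Ω : Type} {T d : ℕ} (ℱ : Fin (T+1) → MeasurableSpace Ω)
    (hℱ_mono : Monotone ℱ) (z : Ω → Fin (T+1) → Fin d → ℝ)
    (hz : ∀ t, Measurable[ℱ t] (fun ω => z ω t)) (t : Fin (T+1)) :
    Measurable[ℱ t] (fun ω => deltaX (z ω) t) := by
  unfold deltaX
  by_cases h : (t : ℕ) = 0
  · simp only [h, if_true, sub_zero]; exact hz t
  · simp only [h, if_false]
    refine (hz t).sub ((hz _).mono (hℱ_mono ?_) le_rfl)
    rw [Fin.le_def]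
    exact Nat.sub_le _ _

lemma ocp_Vmeas {Ω : Type} {m m' : MeasurableSpace Ω} {d : ℕ} (hm : m ≤ m')
    (V : (Fin d → ℝ) → Ω → EReal)
    (hV_meas : @Measurable ((Fin d → ℝ) × Ω) EReal
      (MeasurableSpace.prod inferInstance m) _ (fun p => V p.1 p.2))
    (c : Ω → Fin d → ℝ) (hc : Measurable[m'] c) : Measurable[m'] (fun ω => V (c ω) ω) := by
  have h1 : @Measurable Ω ((Fin d → ℝ) × Ω) m' (MeasurableSpace.prod inferInstance m)
      (fun ω => (c ω, ω)) :=
    @Measurable.prodMk Ω m' (Fin d → ℝ) Ω _ m c (fun ω => ω) hc (measurable_id'' hm)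
  exact hV_meas.comp h1

lemma ocp_f_meas {Ω : Type} {mΩ : MeasurableSpace Ω} {T d : ℕ}
    (ℱ : Fin (T+1) → MeasurableSpace Ω)
    (hℱ_le : ∀ t, ℱ t ≤ mΩ) (hℱ_mono : Monotone ℱ)
    (C : Fin (T+1) → Ω → Set (Fin d → ℝ))
    (hC_meas : ∀ t, ∀ O : Set (Fin d → ℝ), IsOpen O →
      MeasurableSet[ℱ t] {ω | (C t ω ∩ O).Nonempty})
    (hC_closed : ∀ t ω, IsClosed (C t ω))
    (hC_zero : ∀ t ω, (0 : Fin d → ℝ) ∈ C t ω)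
    (V : Fin (T+1) → (Fin d → ℝ) → Ω → EReal)
    (hV_meas : ∀ t, @Measurable ((Fin d → ℝ) × Ω) EReal
      (MeasurableSpace.prod inferInstance (ℱ t)) _ (fun p => V t p.1 p.2))
    (x : (Ω → Fin (T+1) → Fin d → ℝ) × (Ω → Fin (T+1) → Fin d → ℝ)) (hx : x ∈ NOCP d ℱ)
    (u : Ω → Fin (T+1) → Fin d → ℝ) (hu : Measurable u) :
    Measurable (fun ω => fOCP C V (x.1 ω) (x.2 ω) (u ω) ω) := by
  classical
  unfold fOCP
  have hk : ∀ t, Measurable (fun ω => x.2 ω t) := fun t => (hx.2 t).mono (hℱ_le t) le_rfl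
  have hz : ∀ t, Measurable (fun ω => x.1 ω t) := fun t => (hx.1 t).mono (hℱ_le t) le_rfl
  have hd : ∀ t, Measurable (fun ω => deltaX (x.1 ω) t) := fun t =>
    (ocp_deltaX_meas ℱ hℱ_mono x.1 hx.1 t).mono (hℱ_le t) le_rfl
  refine Measurable.add (Finset.measurable_fun_sum _ (fun t _ => Measurable.add ?_ ?_)) ?_
  · exact ocp_Vmeas (hℱ_le t) (V t) (hV_meas t) _ (hk t).neg
  · refine Measurable.ite ?_ measurable_const measurable_const
    refine ocp_mem_meas (C t) (fun O hO => hℱ_le t _ (hC_meas t O hO)) (hC_closed t)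
      (fun ω => ⟨0, hC_zero t ω⟩) _ ?_
    exact ((hd t).add ((measurable_pi_apply t).comp hu)).add (hk t)
  · refine Measurable.ite ?_ measurable_const measurable_const
    exact (hz _) (measurableSet_singleton 0)

/-- The market data. -/
structure OcpMkt {Ω : Type} (mΩ : MeasurableSpace Ω) {T d : ℕ}
    (ℱ : Fin (T+1) → MeasurableSpace Ω) (C : Fin (T+1) → Ω → Set (Fin d → ℝ))
    (V : Fin (T+1) → (Fin d → ℝ) → Ω → EReal) : Prop where
  le : ∀ t, ℱ t ≤ mΩ
  mono : Monotone ℱ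
  C_meas : ∀ t, ∀ O : Set (Fin d → ℝ), IsOpen O →
      MeasurableSet[ℱ t] {ω | (C t ω ∩ O).Nonempty}
  C_closed : ∀ t ω, IsClosed (C t ω)
  C_convex : ∀ t ω, Convex ℝ (C t ω)
  C_zero : ∀ t ω, (0 : Fin d → ℝ) ∈ C t ω
  V_meas : ∀ t, @Measurable ((Fin d → ℝ) × Ω) EReal
      (MeasurableSpace.prod inferInstance (ℱ t)) _ (fun p => V t p.1 p.2)
  V_proper : ∀ t ω, ∀ c, V t c ω ≠ ⊥
  V_lsc : ∀ t ω, LowerSemicontinuous (fun c => V t c ω)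
  V_convex : ∀ (t : Fin (T+1)) (ω : Ω) (a b : ℝ) (c₁ c₂ : Fin d → ℝ),
      0 < a → 0 < b → a + b = 1 →
      V t (a • c₁ + b • c₂) ω ≤ (a : EReal) * V t c₁ ω + (b : EReal) * V t c₂ ω
  V_mono : ∀ t ω (c c' : Fin d → ℝ), (∀ i, c i ≤ c' i) → V t c ω ≤ V t c' ω
  V_zero : ∀ t ω, V t 0 ω = 0

lemma ocp_abel {T d : ℕ} (D y : Fin (T+1) → Fin d → ℝ) :
    ∑ t, dotd (deltaX D t) (y t) = - ∑ t, dotd (D t) (deltaNext y t) := by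
  unfold deltaX deltaNext
  simp only [ocp_dotd_sub_left, ocp_dotd_sub_right, Finset.sum_sub_distrib]
  have h1 : ∑ t : Fin (T+1), dotd (if (t : ℕ) = 0 then 0 else
      D ⟨(t : ℕ) - 1, Nat.lt_of_le_of_lt (Nat.sub_le _ _) t.isLt⟩) (y t)
      = ∑ s : Fin T, dotd (D s.castSucc) (y s.succ) := by
    rw [Fin.sum_univ_succ]
    simp only [Fin.val_zero, if_true, ocp_dotd_zero_left, zero_add]
    refine Finset.sum_congr rfl (fun s _ => ?_)
    rw [if_neg (by simp)]
    rfl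
  have h2 : ∑ t : Fin (T+1), dotd (D t) (if h : (t : ℕ) = T then 0 else
      y ⟨(t : ℕ) + 1, Nat.succ_lt_succ (Nat.lt_of_le_of_ne (Nat.lt_succ_iff.mp t.isLt) h)⟩)
      = ∑ s : Fin T, dotd (D s.castSucc) (y s.succ) := by
    rw [Fin.sum_univ_castSucc]
    rw [dif_pos (by simp), ocp_dotd_comm, ocp_dotd_zero_left, add_zero]
    refine Finset.sum_congr rfl (fun s _ => ?_)
    rw [dif_neg (by simp [s.isLt.ne])]
    rfl
  rw [h1, h2]; ring

lemma ocp_deltaX_sub {T d : ℕ} (x y : Fin (T+1) → Fin d → ℝ) (t : Fin (T+1)) :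
    deltaX (x - y) t = deltaX x t - deltaX y t := by
  have := ocp_deltaX_lin 1 (-1) x y t
  simpa [sub_eq_add_neg] using this

lemma ocp_fenchel_sigma {Ω : Type} {T d : ℕ} (C : Fin (T+1) → Ω → Set (Fin d → ℝ))
    (t : Fin (T+1)) (ω : Ω) (c y : Fin d → ℝ) 
    (h : ∀ y' : Fin d → ℝ, sigmaC C t ω y + ((dotd c (y' - y) : ℝ) : EReal) ≤ sigmaC C t ω y') :
    ∀ c' ∈ C t ω, dotd c' y ≤ dotd c y := by
  intro c' hc'
  have h0 := h 0
  have h1 : sigmaC C t ω 0 ≤ 0 := by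
    unfold sigmaC
    refine iSup₂_le (fun a _ => ?_)
    rw [ocp_dotd_comm, ocp_dotd_zero_left]; simp
  have h2 : ((dotd c' y : ℝ) : EReal) ≤ sigmaC C t ω y := by
    unfold sigmaC
    exact le_iSup₂ (f := fun a (_ : a ∈ C t ω) => ((dotd a y : ℝ) : EReal)) c' hc'
  have h3 : ((dotd c' y : ℝ) : EReal) + ((dotd c (0 - y) : ℝ) : EReal) ≤ 0 :=
    (add_le_add h2 le_rfl).trans (h0.trans h1)
  rw [← EReal.coe_add, ← EReal.coe_zero, EReal.coe_le_coe_iff, zero_sub, ocp_dotd_comm c,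
    ocp_dotd_neg_left, ocp_dotd_comm y] at h3
  linarith

lemma ocp_suff {Ω : Type} {mΩ : MeasurableSpace Ω} (P : Measure Ω) [IsProbabilityMeasure P]
    {T d : ℕ} (ℱ : Fin (T+1) → MeasurableSpace Ω) (C : Fin (T+1) → Ω → Set (Fin d → ℝ))
    (V : Fin (T+1) → (Fin d → ℝ) → Ω → EReal) (M : OcpMkt mΩ ℱ C V)
    (u : Ω → Fin (T+1) → Fin d → ℝ) (hum : Measurable u)
    (x x' : (Ω → Fin (T+1) → Fin d → ℝ) × (Ω → Fin (T+1) → Fin d → ℝ))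
    (hx : x ∈ NOCP d ℱ) (hx' : x' ∈ NOCP d ℱ)
    (hnb : intOCP P C V x u ≠ ⊥) (hnb' : intOCP P C V x' u ≠ ⊥) (hnt : intOCP P C V x u ≠ ⊤)
    (y : Ω → Fin (T+1) → Fin d → ℝ)
    (hyi : ∀ t, Integrable (fun ω => y ω t) P)
    (hmart : ∀ t : Fin (T+1), ∀ ht : (t : ℕ) < T, ∀ A : Set Ω, MeasurableSet[ℱ t] A →
              ∫ ω in A, y ω ⟨(t : ℕ) + 1, Nat.succ_lt_succ ht⟩ ∂P =
                ∫ ω in A, y ω t ∂P)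
    (hsub : ∀ t, ∀ᵐ ω ∂P,
              (∀ y' : Fin d → ℝ,
                VconjOCP V t (y ω t) ω +
                  ((dotd (-(x.2 ω t)) (y' - y ω t) : ℝ) : EReal) ≤ VconjOCP V t y' ω) ∧
              (∀ y' : Fin d → ℝ,
                sigmaC C t ω (y ω t) +
                  ((dotd (deltaX (x.1 ω) t + u ω t + x.2 ω t) (y' - y ω t) : ℝ) : EReal) ≤
                  sigmaC C t ω y')) :
    intOCP P C V x u ≤ intOCP P C V x' u := by
  by_cases hnt' : intOCP P C V x' u = ⊤
  · rw [hnt']; exact le_top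
  obtain ⟨F, hFi, hFe, hFE⟩ := ocp_EE_fin P _
    (ocp_f_meas ℱ M.le M.mono C M.C_meas M.C_closed M.C_zero V M.V_meas x hx u hum) hnt hnb
  obtain ⟨F', hFi', hFe', hFE'⟩ := ocp_EE_fin P _
    (ocp_f_meas ℱ M.le M.mono C M.C_meas M.C_closed M.C_zero V M.V_meas x' hx' u hum) hnt' hnb'
  unfold intOCP
  rw [hFE, hFE', EReal.coe_le_coe_iff]
  have hyc : ∀ t i, Integrable (fun ω => y ω t i) P := fun t i => (integrable_pi_iff.1 (hyi t)) i
  -- the increments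
  let w : Fin (T+1) × Fin d → Ω → ℝ := fun j ω =>
    if h : (j.1 : ℕ) < T then y ω ⟨(j.1 : ℕ) + 1, Nat.succ_lt_succ h⟩ j.2 - y ω j.1 j.2 else 0
  have hwi : ∀ j, Integrable (w j) P := by
    intro j
    by_cases h : (j.1 : ℕ) < T
    · simp only [w, h, dif_pos]
      exact (hyc _ _).sub (hyc _ _)
    · simp only [w, h, dif_neg, not_false_eq_true]; exact integrable_zero _ _ _
  have hw0 : ∀ j, P[w j | ℱ j.1] =ᵐ[P] 0 := by
    intro j
    symm
    refine ae_eq_condExp_of_forall_setIntegral_eq (M.le j.1) (hwi j)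
      (fun _ _ _ => (integrable_zero _ _ _).integrableOn) ?_ ?_
    · intro A hA _
      by_cases h : (j.1 : ℕ) < T
      · simp only [w, h, dif_pos]
        rw [integral_sub (hyc _ _).integrableOn (hyc _ _).integrableOn]
        have h1 := congrFun (hmart j.1 h A hA) j.2
        rw [eval_integral (fun i => (hyc _ i).integrableOn),
          eval_integral (fun i => (hyc _ i).integrableOn)] at h1
        simp [h1]
      · simp [w, h]
    · exact stronglyMeasurable_zero.aestronglyMeasurable
  have key := ocp_key P ℱ M.le M.mono (fun j ω => - (x'.1 ω j.1 j.2 - x.1 ω j.1 j.2))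
    (fun j => by
      have e1 := hx.1 j.1
      have e2 := hx'.1 j.1
      exact (((measurable_pi_apply j.2).comp e2).sub ((measurable_pi_apply j.2).comp e1)).neg)
    (T+1) le_rfl w hwi (fun j _ => hw0 j) (fun ω => F' ω - F ω) (hFi'.sub hFi) ?_
  · rw [integral_sub hFi' hFi] at key; linarith
  filter_upwards [hFe, hFe', ae_all_iff.2 hsub] with ω e1 e2 e3
  obtain ⟨c1, z1, v1, s1⟩ := ocp_f_fin C V _ _ _ ω (fun t c => M.V_proper t ω c) _ e1
  obtain ⟨c2, z2, v2, s2⟩ := ocp_f_fin C V _ _ _ ω (fun t c => M.V_proper t ω c) _ e2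
  have hstep : ∀ t, (V t (-(x.2 ω t)) ω).toReal + dotd (deltaX (x'.1 ω - x.1 ω) t) (y ω t)
      ≤ (V t (-(x'.2 ω t)) ω).toReal := by
    intro t
    have f1 := ocp_fenchel (fun c => V t c ω) (M.V_lsc t ω) (M.V_convex t ω) _ _ _ (v1 t)
      (e3 t).1 (-(x'.2 ω t))
    rw [v2 t, EReal.coe_le_coe_iff] at f1
    have f2 := ocp_fenchel_sigma C t ω _ _ (e3 t).2 _ (c2 t)
    rw [ocp_deltaX_sub]
    simp only [ocp_dotd_sub_left, ocp_dotd_add_left, ocp_dotd_neg_left] at f1 f2 ⊢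
    linarith
  have hsum := Finset.sum_le_sum (fun t (_ : t ∈ Finset.univ) => hstep t)
  rw [Finset.sum_add_distrib, ← s1, ← s2, ocp_abel] at hsum
  have hfil : (Finset.univ.filter (fun j : Fin (T+1) × Fin d => (j.1 : ℕ) < T + 1)) = Finset.univ := by
    ext j; simp only [Finset.mem_filter, Finset.mem_univ, true_and, iff_true]; exact j.1.isLt
  rw [hfil]
  have hfin : ∑ j : Fin (T+1) × Fin d, -(x'.1 ω j.1 j.2 - x.1 ω j.1 j.2) * w j ω =
      - ∑ t, dotd ((x'.1 ω - x.1 ω) t) (deltaNext (y ω) t) := by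
    rw [Fintype.sum_prod_type, ← Finset.sum_neg_distrib]
    refine Finset.sum_congr rfl (fun t _ => ?_)
    by_cases h : (t : ℕ) < T
    · unfold dotd deltaNext
      rw [← Finset.sum_neg_distrib]
      refine Finset.sum_congr rfl (fun i _ => ?_)
      simp only [w, h, dif_pos, dif_neg h.ne]
      simp only [Pi.sub_apply]
      ring
    · have ht : t = Fin.last T := by
        apply Fin.ext; simp; have := t.isLt; omega
      subst ht
      simp [w, z1, z2, ocp_dotd_zero_left]
  rw [hfin]
  linarith

/-! ### Function spaces -/

lemma ocp_bdd_mem {Ω : Type} {mΩ : MeasurableSpace Ω} (P : Measure Ω)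
    {T d : ℕ} (S : Submodule ℝ (Ω → Fin (T+1) → Fin d → ℝ))
    (hS : DecomposableB P (S : Set (Ω → Fin (T+1) → Fin d → ℝ)))
    (v : Ω → Fin (T+1) → Fin d → ℝ) (hv : Measurable v) (M : ℝ) (hM : ∀ ω, ‖v ω‖ ≤ M) : v ∈ S := by
  have := hS ∅ MeasurableSet.empty 0 S.zero_mem v hv ⟨M, Filter.Eventually.of_forall hM⟩
  simpa using this

lemma ocp_dotB_single {T d : ℕ} (v : Fin (T+1) → Fin d → ℝ) (t : Fin (T+1)) (i : Fin d) :
    dotB v (Pi.single t (Pi.single i 1)) = v t i := by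
  classical
  unfold dotB
  rw [Finset.sum_eq_single t]
  · simp [dotd, Pi.single_apply]
  · intro s _ hs
    simp [dotd, Pi.single_eq_of_ne hs]
  · simp

lemma ocp_dotB_comm {T d : ℕ} (v w : Fin (T+1) → Fin d → ℝ) : dotB v w = dotB w v := by
  unfold dotB; simp only [ocp_dotd_comm]

lemma ocp_int_comp {Ω : Type} {mΩ : MeasurableSpace Ω} (P : Measure Ω)
    {T d : ℕ} (𝓤 𝓨 : Submodule ℝ (Ω → Fin (T+1) → Fin d → ℝ))
    (h𝓨dec : DecomposableB P (𝓨 : Set (Ω → Fin (T+1) → Fin d → ℝ)))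
    (hpair : ∀ u ∈ 𝓤, ∀ y ∈ 𝓨, Integrable (fun ω => dotB (u ω) (y ω)) P)
    (v : Ω → Fin (T+1) → Fin d → ℝ) (hv : v ∈ 𝓤) (t : Fin (T+1)) (i : Fin d) :
    Integrable (fun ω => v ω t i) P := by
  have := hpair v hv (fun _ => Pi.single t (Pi.single i 1))
    (ocp_bdd_mem P 𝓨 h𝓨dec _ measurable_const _ (fun _ => le_rfl))
  simpa only [ocp_dotB_single] using this

lemma ocp_aProj_comp {Ω : Type} {mΩ : MeasurableSpace Ω} (P : Measure Ω) [IsProbabilityMeasure P]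
    {T d : ℕ} (ℱ : Fin (T+1) → MeasurableSpace Ω)
    (v : Ω → Fin (T+1) → Fin d → ℝ) (hv : ∀ t, Integrable (fun ω => v ω t) P)
    (t : Fin (T+1)) (i : Fin d) :
    (fun ω => aProj P ℱ v ω t i) =ᵐ[P] P[fun ω => v ω t i | ℱ t] := by
  exact ContinuousLinearMap.comp_condExp_comm (hv t)
    (ContinuousLinearMap.proj (R := ℝ) (φ := fun _ : Fin d => ℝ) i)

lemma ocp_aProj_meas {Ω : Type} {mΩ : MeasurableSpace Ω} (P : Measure Ω)
    {T d : ℕ} (ℱ : Fin (T+1) → MeasurableSpace Ω)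
    (v : Ω → Fin (T+1) → Fin d → ℝ) (t : Fin (T+1)) :
    Measurable[ℱ t] (fun ω => aProj P ℱ v ω t) :=
  stronglyMeasurable_condExp.measurable

lemma ocp_aProj_adapted {Ω : Type} {mΩ : MeasurableSpace Ω} (P : Measure Ω) [IsProbabilityMeasure P]
    {T d : ℕ} (ℱ : Fin (T+1) → MeasurableSpace Ω) (hle : ∀ t, ℱ t ≤ mΩ)
    (v : Ω → Fin (T+1) → Fin d → ℝ) (hv : ∀ t, Integrable (fun ω => v ω t) P)
    (hva : ∀ t, Measurable[ℱ t] (fun ω => v ω t)) : aProj P ℱ v = v := by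
  funext ω t
  unfold aProj
  rw [condExp_of_stronglyMeasurable (hle t) (Measurable.stronglyMeasurable (hva t)) (hv t)]

lemma ocp_aProj_lin {Ω : Type} {mΩ : MeasurableSpace Ω} (P : Measure Ω) [IsProbabilityMeasure P]
    {T d : ℕ} (ℱ : Fin (T+1) → MeasurableSpace Ω)
    (v w : Ω → Fin (T+1) → Fin d → ℝ) (hv : ∀ t, Integrable (fun ω => v ω t) P)
    (hw : ∀ t, Integrable (fun ω => w ω t) P) (a b : ℝ) :
    aProj P ℱ (a • v + b • w) =ᵐ[P] a • aProj P ℱ v + b • aProj P ℱ w := by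
  have h : ∀ t, P[fun ω => (a • v + b • w) ω t | ℱ t] =ᵐ[P]
      a • P[fun ω => v ω t | ℱ t] + b • P[fun ω => w ω t | ℱ t] := by
    intro t
    have h1 := condExp_add ((hv t).smul a) ((hw t).smul b) (ℱ t)
    have h2 := condExp_smul (μ := P) a (fun ω => v ω t) (ℱ t)
    have h3 := condExp_smul (μ := P) b (fun ω => w ω t) (ℱ t)
    exact h1.trans (h2.add h3)
  filter_upwards [ae_all_iff.2 h] with ω hω
  funext t
  exact hω t

lemma ocp_pair_proj {Ω : Type} {mΩ : MeasurableSpace Ω} (P : Measure Ω) [IsProbabilityMeasure P]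
    {T d : ℕ} (ℱ : Fin (T+1) → MeasurableSpace Ω) (hle : ∀ t, ℱ t ≤ mΩ)
    (δ y : Ω → Fin (T+1) → Fin d → ℝ) (hy : ∀ t, Integrable (fun ω => y ω t) P)
    (hδ : ∀ t, Measurable[ℱ t] (fun ω => δ ω t)) (M : ℝ) (hM : ∀ ω, ‖δ ω‖ ≤ M) :
    pairB P δ y = pairB P δ (aProj P ℱ y) := by
  have hb : ∀ ω t i, ‖δ ω t i‖ ≤ M := fun ω t i =>
    (norm_le_pi_norm _ i).trans ((norm_le_pi_norm _ t).trans (hM ω))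
  have hyc : ∀ t i, Integrable (fun ω => y ω t i) P := fun t i => (integrable_pi_iff.1 (hy t)) i
  have hδc : ∀ t i, Measurable[ℱ t] (fun ω => δ ω t i) := fun t i =>
    (measurable_pi_apply i).comp (hδ t)
  have hY : ∀ t i, Integrable (fun ω => aProj P ℱ y ω t i) P := fun t i =>
    integrable_condExp.congr (ocp_aProj_comp P ℱ y hy t i).symm
  have i1 : ∀ t i, Integrable (fun ω => δ ω t i * y ω t i) P := fun t i =>
    (hyc t i).bdd_mul ((hδc t i).mono (hle t) le_rfl).aestronglyMeasurable
      (Filter.Eventually.of_forall (fun ω => hb ω t i))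
  have i2 : ∀ t i, Integrable (fun ω => δ ω t i * aProj P ℱ y ω t i) P := fun t i =>
    (hY t i).bdd_mul ((hδc t i).mono (hle t) le_rfl).aestronglyMeasurable
      (Filter.Eventually.of_forall (fun ω => hb ω t i))
  unfold pairB dotB dotd
  rw [integral_finsetSum _ (fun t _ => integrable_finsetSum _ (fun i _ => i1 t i)),
    integral_finsetSum _ (fun t _ => integrable_finsetSum _ (fun i _ => i2 t i))]
  refine Finset.sum_congr rfl (fun t _ => ?_)
  rw [integral_finsetSum _ (fun i _ => i1 t i), integral_finsetSum _ (fun i _ => i2 t i)]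
  refine Finset.sum_congr rfl (fun i _ => ?_)
  have h1 := condExp_mul_of_stronglyMeasurable_left (m := ℱ t) (μ := P)
    (Measurable.stronglyMeasurable (hδc t i)) (i1 t i) (hyc t i)
  have h2 := integral_condExp (μ := P) (hle t) (f := fun ω => δ ω t i * y ω t i)
  rw [← h2]
  refine integral_congr_ae ?_
  refine Filter.EventuallyEq.trans h1 ?_
  filter_upwards [ocp_aProj_comp P ℱ y hy t i] with ω hω
  simp only [Pi.mul_apply]
  rw [← hω]

/-! ### The value function -/

lemma ocp_phi_congr {Ω : Type} {mΩ : MeasurableSpace Ω} (P : Measure Ω)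
    {T d : ℕ} (ℱ : Fin (T+1) → MeasurableSpace Ω) (C : Fin (T+1) → Ω → Set (Fin d → ℝ))
    (V : Fin (T+1) → (Fin d → ℝ) → Ω → EReal) (u u' : Ω → Fin (T+1) → Fin d → ℝ)
    (h : u =ᵐ[P] u') : phiOCP P C V ℱ u = phiOCP P C V ℱ u' := by
  unfold phiOCP intOCP
  refine iInf_congr (fun x => iInf_congr (fun _ => ocp_EE_congr P _ _ ?_))
  filter_upwards [h] with ω hω
  rw [hω]

lemma ocp_deltaX_sum {T d : ℕ} (v : Fin (T+1) → Fin d → ℝ) (t : Fin (T+1)) :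
    deltaX (fun t => ∑ s ∈ Finset.Iic t, v s) t = v t := by
  unfold deltaX
  split_ifs with h
  · have : t = 0 := Fin.ext h
    subst this
    have : Finset.Iic (0 : Fin (T+1)) = {0} := by ext s; simp
    simp only [this]; simp
  · have h2 : Finset.Iic t = insert t (Finset.Iic
      (⟨(t : ℕ) - 1, Nat.lt_of_le_of_lt (Nat.sub_le _ _) t.isLt⟩ : Fin (T+1))) := by
      ext s
      simp only [Finset.mem_Iic, Finset.mem_insert, Fin.le_def, Fin.ext_iff]
      omega
    simp only []
    rw [h2, Finset.sum_insert]
    · simp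
    · simp only [Finset.mem_Iic, Fin.le_def]; omega

lemma ocp_deltaX_last {T d : ℕ} (c : Fin d → ℝ) (t : Fin (T+1)) :
    deltaX (fun t => if t = Fin.last T then c else 0) t = if t = Fin.last T then c else 0 := by
  have h : ∀ h : (t : ℕ) ≠ 0,
    (⟨(t : ℕ) - 1, Nat.lt_of_le_of_lt (Nat.sub_le _ _) t.isLt⟩ : Fin (T+1)) ≠ Fin.last T := by
    intro h h2
    have := congrArg Fin.val h2
    simp at this
    have := t.isLt
    omega
  unfold deltaX
  split_ifs with h1 h2 <;> simp_all

lemma ocp_phi_le_VT {Ω : Type} {mΩ : MeasurableSpace Ω} (P : Measure Ω)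
    {T d : ℕ} (ℱ : Fin (T+1) → MeasurableSpace Ω) (C : Fin (T+1) → Ω → Set (Fin d → ℝ))
    (V : Fin (T+1) → (Fin d → ℝ) → Ω → EReal) (M : OcpMkt mΩ ℱ C V)
    (v : Ω → Fin (T+1) → Fin d → ℝ) (hv : ∀ t, Measurable[ℱ t] (fun ω => v ω t)) :
    phiOCP P C V ℱ v ≤ EE P (fun ω => V (Fin.last T) (∑ t, v ω t) ω) := by
  classical
  have hsm : ∀ t, Measurable[ℱ t] (fun ω => ∑ s ∈ Finset.Iic t, v ω s) := by
    intro t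
    refine Finset.measurable_fun_sum _ (fun s hs => ?_)
    exact (hv s).mono (M.mono (Finset.mem_Iic.1 hs)) le_rfl
  have hlast : ∀ t, Measurable[ℱ t] (fun ω => if t = Fin.last T then ∑ s, v ω s else 0) := by
    intro t
    by_cases h : t = Fin.last T
    · subst h
      have := hsm (Fin.last T)
      have e : Finset.Iic (Fin.last T) = Finset.univ := by ext s; simp [Fin.le_last]
      rw [e] at this
      simpa using this
    · simp only [h, if_false]; exact measurable_const
  let z : Ω → Fin (T+1) → Fin d → ℝ := fun ω =>
    (-1 : ℝ) • (fun t => ∑ s ∈ Finset.Iic t, v ω s) +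
      (1 : ℝ) • (fun t => if t = Fin.last T then ∑ s, v ω s else 0)
  let k : Ω → Fin (T+1) → Fin d → ℝ := fun ω t => - (if t = Fin.last T then ∑ s, v ω s else 0)
  have hmem : (z, k) ∈ NOCP d ℱ := by
    refine ⟨fun t => ?_, fun t => (hlast t).neg⟩
    exact ((hsm t).const_smul (-1 : ℝ)).add ((hlast t).const_smul (1 : ℝ))
  refine (iInf₂_le (f := fun x _ => intOCP P C V x v) (z, k) hmem).trans (le_of_eq ?_)
  unfold intOCP
  refine ocp_EE_congr P _ _ (Filter.Eventually.of_forall (fun ω => ?_))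
  rw [ocp_f_of]
  · rw [Finset.sum_eq_single (Fin.last T)]
    · simp [k]
    · intro t _ ht
      simp [k, ht, M.V_zero]
    · simp
  · intro t
    have : deltaX (z ω) t + v ω t + k ω t = 0 := by
      simp only [z, k]
      rw [ocp_deltaX_lin, ocp_deltaX_sum, ocp_deltaX_last]
      simp
    simp only [this]
    exact M.C_zero t ω
  · have e : Finset.Iic (Fin.last T) = Finset.univ := by ext s; simp [Fin.le_last]
    simp [z, e]

lemma ocp_phi_convex {Ω : Type} {mΩ : MeasurableSpace Ω} (P : Measure Ω) [IsProbabilityMeasure P]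
    {T d : ℕ} (ℱ : Fin (T+1) → MeasurableSpace Ω) (C : Fin (T+1) → Ω → Set (Fin d → ℝ))
    (V : Fin (T+1) → (Fin d → ℝ) → Ω → EReal) (M : OcpMkt mΩ ℱ C V)
    (u₁ u₂ : Ω → Fin (T+1) → Fin d → ℝ) (h₁ : Measurable u₁) (h₂ : Measurable u₂)
    (r₁ r₂ : ℝ) (e₁ : phiOCP P C V ℱ u₁ = (r₁ : EReal)) (e₂ : phiOCP P C V ℱ u₂ = (r₂ : EReal))
    (a b : ℝ) (ha : 0 < a) (hb : 0 < b) (hab : a + b = 1) :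
    phiOCP P C V ℱ (a • u₁ + b • u₂) ≤ ((a * r₁ + b * r₂ : ℝ) : EReal) := by
  have aux : ∀ (u : Ω → Fin (T+1) → Fin d → ℝ) (r : ℝ), Measurable u →
      phiOCP P C V ℱ u = (r : EReal) → ∀ ε > 0, ∃ x ∈ NOCP d ℱ, ∃ F : Ω → ℝ, Integrable F P ∧
        (∀ᵐ ω ∂P, fOCP C V (x.1 ω) (x.2 ω) (u ω) ω = (F ω : EReal)) ∧ ∫ ω, F ω ∂P < r + ε := by
    intro u r hu e ε hε
    have hlt : phiOCP P C V ℱ u < ((r + ε : ℝ) : EReal) := by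
      rw [e, EReal.coe_lt_coe_iff]; linarith
    unfold phiOCP at hlt
    simp only [iInf_lt_iff] at hlt
    obtain ⟨x, hx, hlt⟩ := hlt
    have hge : (r : EReal) ≤ intOCP P C V x u := by
      rw [← e]; exact iInf₂_le (f := fun x _ => intOCP P C V x u) x hx
    obtain ⟨F, hFi, hFe, hFE⟩ := ocp_EE_fin P _
      (ocp_f_meas ℱ M.le M.mono C M.C_meas M.C_closed M.C_zero V M.V_meas x hx u hu)
      (ne_top_of_lt hlt) (fun h => by
        unfold intOCP at hge; rw [h] at hge
        exact absurd hge (not_le.2 (EReal.bot_lt_coe r)))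
    refine ⟨x, hx, F, hFi, hFe, ?_⟩
    unfold intOCP at hlt
    rw [hFE, EReal.coe_lt_coe_iff] at hlt
    exact hlt
  apply EReal.le_of_forall_lt_iff_le.1
  intro q hq
  rw [EReal.coe_lt_coe_iff] at hq
  set ε := q - (a * r₁ + b * r₂) with hε
  obtain ⟨x₁, hx₁, F₁, i₁, f₁, l₁⟩ := aux u₁ r₁ h₁ e₁ ε (by linarith)
  obtain ⟨x₂, hx₂, F₂, i₂, f₂, l₂⟩ := aux u₂ r₂ h₂ e₂ ε (by linarith)
  have hx : (a • x₁ + b • x₂) ∈ NOCP d ℱ := by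
    refine ⟨fun t => ?_, fun t => ?_⟩
    · exact ((hx₁.1 t).const_smul a).add ((hx₂.1 t).const_smul b)
    · exact ((hx₁.2 t).const_smul a).add ((hx₂.2 t).const_smul b)
  refine (iInf₂_le (f := fun x _ => intOCP P C V x (a • u₁ + b • u₂)) _ hx).trans ?_
  have hint : Integrable (fun ω => a * F₁ ω + b * F₂ ω) P := (i₁.const_mul a).add (i₂.const_mul b)
  have : intOCP P C V (a • x₁ + b • x₂) (a • u₁ + b • u₂) ≤
      EE P (fun ω => ((a * F₁ ω + b * F₂ ω : ℝ) : EReal)) := by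
    refine ocp_EE_mono P _ _ ?_
    filter_upwards [f₁, f₂] with ω g₁ g₂
    obtain ⟨c1, z1, v1, s1⟩ := ocp_f_fin C V _ _ _ ω (fun t c => M.V_proper t ω c) _ g₁
    obtain ⟨c2, z2, v2, s2⟩ := ocp_f_fin C V _ _ _ ω (fun t c => M.V_proper t ω c) _ g₂
    rw [ocp_f_of]
    · rw [s1, s2, Finset.mul_sum, Finset.mul_sum, ← Finset.sum_add_distrib, ocp_coe_sum]
      refine Finset.sum_le_sum (fun t _ => ?_)
      have := M.V_convex t ω a b (-(x₁.2 ω t)) (-(x₂.2 ω t)) ha hb hab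
      rw [v1 t, v2 t] at this
      refine le_trans (le_of_eq ?_) (this.trans (le_of_eq ?_))
      · congr 1
        simp only [Prod.snd_add, Prod.smul_snd, Pi.add_apply, Pi.smul_apply]
        module
      · push_cast; rfl
    · intro t
      have := M.C_convex t ω (c1 t) (c2 t) ha.le hb.le hab
      convert this using 1
      simp only [Prod.fst_add, Prod.smul_fst, Prod.snd_add, Prod.smul_snd, Pi.add_apply,
        Pi.smul_apply]
      rw [ocp_deltaX_lin]
      module
    · simp [z1, z2]
  refine this.trans ?_
  rw [ocp_EE_real P _ hint, EReal.coe_le_coe_iff, integral_add (i₁.const_mul a) (i₂.const_mul b),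
    integral_const_mul, integral_const_mul]
  nlinarith [mul_lt_mul_of_pos_left l₁ ha, mul_lt_mul_of_pos_left l₂ hb]

/-! ### Neighbourhoods of the origin -/

lemma ocp_absorbent {E : Type*} [AddCommGroup E] [Module ℝ E] (S : Set E)
    (h : ∀ v, ∃ r : ℝ, 0 < r ∧ ∀ a : ℝ, |a| < r → a • v ∈ S) : Absorbent ℝ S := by
  rw [absorbent_iff_eventually_nhdsNE_zero]
  intro v
  obtain ⟨r, hr, hv⟩ := h v
  have hev : ∀ᶠ a : ℝ in nhdsWithin 0 {0}ᶜ, a ∈ Metric.ball (0:ℝ) r :=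
    nhdsWithin_le_nhds (Metric.ball_mem_nhds _ hr)
  filter_upwards [hev] with a ha
  rw [Metric.mem_ball, dist_zero_right, Real.norm_eq_abs] at ha
  exact hv a ha

/-- The linear form defined by an element of the dual space. -/
def ocp_pairL {Ω : Type} {mΩ : MeasurableSpace Ω} (P : Measure Ω)
    {T d : ℕ} (𝓤 : Submodule ℝ (Ω → Fin (T+1) → Fin d → ℝ)) (y : Ω → Fin (T+1) → Fin d → ℝ)
    (hpair : ∀ u ∈ 𝓤, Integrable (fun ω => dotB (u ω) (y ω)) P) : ↥𝓤 →ₗ[ℝ] ℝ where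
  toFun v := pairB P (v : Ω → Fin (T+1) → Fin d → ℝ) y
  map_add' v w := by
    unfold pairB
    rw [← integral_add (hpair _ v.2) (hpair _ w.2)]
    congr 1
    funext ω
    simp only [dotB, Submodule.coe_add, Pi.add_apply, ocp_dotd_add_left, Finset.sum_add_distrib]
  map_smul' a v := by
    unfold pairB
    simp only [RingHom.id_apply, smul_eq_mul]
    rw [← integral_const_mul]
    congr 1
    funext ω
    simp only [dotB, Submodule.coe_smul, Pi.smul_apply, ocp_dotd_smul_left, Finset.mul_sum]

lemma ocp_L1nhd {Ω : Type} {mΩ : MeasurableSpace Ω} (P : Measure Ω) [IsProbabilityMeasure P]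
    {T d : ℕ} (𝓤 𝓨 : Submodule ℝ (Ω → Fin (T+1) → Fin d → ℝ))
    (h𝓤meas : ∀ u ∈ 𝓤, Measurable u)
    (h𝓨dec : DecomposableB P (𝓨 : Set (Ω → Fin (T+1) → Fin d → ℝ)))
    (hpair : ∀ u ∈ 𝓤, ∀ y ∈ 𝓨, Integrable (fun ω => dotB (u ω) (y ω)) P)
    (τ : TopologicalSpace ↥𝓤)
    (hτ_barrel : ∀ S : Set ↥𝓤, @IsClosed ↥𝓤 τ S → Convex ℝ S → Absorbent ℝ S →
      S ∈ @nhds ↥𝓤 τ 0)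
    (hτ_compat : ∀ g : ↥𝓤 →ₗ[ℝ] ℝ, (@Continuous ↥𝓤 ℝ τ _ g) ↔
      ∃ y ∈ 𝓨, ∀ u : ↥𝓤, g u = pairB P (u : Ω → Fin (T+1) → Fin d → ℝ) y)
    (ε : ℝ) (hε : 0 < ε) :
    {v : ↥𝓤 | ∀ t i, ∫ ω, |(v : Ω → Fin (T+1) → Fin d → ℝ) ω t i| ∂P ≤ ε} ∈ nhds (0 : ↥𝓤) := by
  classical
  set B : Set ↥𝓤 := {v | ∀ y : Ω → Fin (T+1) → Fin d → ℝ, Measurable y → (∀ ω, ‖y ω‖ ≤ 1) →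
    pairB P (v : Ω → Fin (T+1) → Fin d → ℝ) y ≤ ε} with hB
  have hyY : ∀ y : Ω → Fin (T+1) → Fin d → ℝ, Measurable y → (∀ ω, ‖y ω‖ ≤ 1) → y ∈ 𝓨 :=
    fun y h1 h2 => ocp_bdd_mem P 𝓨 h𝓨dec y h1 1 h2
  have hB0 : B ∈ nhds (0 : ↥𝓤) := by
    apply hτ_barrel
    · simp only [hB, Set.ofPred_forall]
      refine isClosed_iInter (fun y => isClosed_iInter (fun h1 => isClosed_iInter (fun h2 => ?_)))
      have hc : Continuous (ocp_pairL P 𝓤 y (fun v hv => hpair v hv y (hyY y h1 h2))) :=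
        (hτ_compat _).2 ⟨y, hyY y h1 h2, fun _ => rfl⟩
      exact isClosed_le hc continuous_const
    · intro v hv w hw a b ha hb hab y h1 h2
      have := (ocp_pairL P 𝓤 y (fun v hv => hpair v hv y (hyY y h1 h2))).map_add (a • v) (b • w)
      rw [map_smul, map_smul] at this
      refine (le_of_eq this).trans ?_
      have e1 := mul_le_mul_of_nonneg_left (hv y h1 h2) ha
      have e2 := mul_le_mul_of_nonneg_left (hw y h1 h2) hb
      have e3 : a * ε + b * ε = ε := by rw [← add_mul, hab, one_mul]
      simp only [smul_eq_mul]
      refine le_trans (add_le_add e1 e2) e3.le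
    · refine ocp_absorbent B ?_
      intro v
      have hvi := fun t i => ocp_int_comp P 𝓤 𝓨 h𝓨dec hpair v v.2 t i
      set c : ℝ := ∑ t, ∑ i, ∫ ω, |(v : Ω → Fin (T+1) → Fin d → ℝ) ω t i| ∂P with hc
      have hbd : ∀ y : Ω → Fin (T+1) → Fin d → ℝ, Measurable y → (∀ ω, ‖y ω‖ ≤ 1) →
          |pairB P (v : Ω → Fin (T+1) → Fin d → ℝ) y| ≤ c := by
        intro y h1 h2
        have e1 : c = ∫ ω, ∑ t, ∑ i, |(v : Ω → Fin (T+1) → Fin d → ℝ) ω t i| ∂P := by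
          rw [integral_finsetSum _ (fun t _ => integrable_finsetSum _ (fun i _ => (hvi t i).abs))]
          refine Finset.sum_congr rfl (fun t _ => ?_)
          rw [integral_finsetSum _ (fun i _ => (hvi t i).abs)]
        rw [e1]
        unfold pairB
        refine (abs_integral_le_integral_abs).trans (integral_mono (hpair v v.2 y (hyY y h1 h2)).abs
          (integrable_finsetSum _ (fun t _ => integrable_finsetSum _ (fun i _ => (hvi t i).abs))) ?_)
        intro ω
        refine (Finset.abs_sum_le_sum_abs _ _).trans (Finset.sum_le_sum (fun t _ => ?_))
        refine (Finset.abs_sum_le_sum_abs _ _).trans (Finset.sum_le_sum (fun i _ => ?_))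
        rw [abs_mul]
        have : |y ω t i| ≤ 1 := (norm_le_pi_norm (y ω t) i).trans
          ((norm_le_pi_norm (y ω) t).trans (h2 ω))
        exact mul_le_of_le_one_right (abs_nonneg _) this
      have hc0 : 0 ≤ c := Finset.sum_nonneg (fun t _ => Finset.sum_nonneg (fun i _ =>
        integral_nonneg (fun ω => abs_nonneg _)))
      refine ⟨ε / (c + 1), by positivity, fun a ha y h1 h2 => ?_⟩
      rw [lt_div_iff₀ (by linarith)] at ha
      have := (ocp_pairL P 𝓤 y (fun v hv => hpair v hv y (hyY y h1 h2))).map_smul a v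
      refine (le_of_eq this).trans ?_
      rw [smul_eq_mul]
      refine (le_abs_self _).trans ?_
      rw [abs_mul]
      have e := mul_le_mul_of_nonneg_left (hbd y h1 h2) (abs_nonneg a)
      have e' : |a| * c ≤ |a| * (c + 1) := mul_le_mul_of_nonneg_left (by linarith) (abs_nonneg a)
      exact e.trans (e'.trans ha.le)
  refine Filter.mem_of_superset hB0 ?_
  intro v hv t i
  have hvm : Measurable (fun ω => (v : Ω → Fin (T+1) → Fin d → ℝ) ω t i) :=
    (measurable_pi_apply i).comp ((measurable_pi_apply t).comp (h𝓤meas v v.2))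
  let s : Ω → ℝ := fun ω => if 0 ≤ (v : Ω → Fin (T+1) → Fin d → ℝ) ω t i then 1 else -1
  have hsm : Measurable s := Measurable.ite (measurableSet_le measurable_const hvm)
    measurable_const measurable_const
  let y : Ω → Fin (T+1) → Fin d → ℝ := fun ω => s ω • Pi.single t (Pi.single i 1)
  have hym : Measurable y := hsm.smul_const _
  have hy1 : ∀ ω, ‖y ω‖ ≤ 1 := by
    intro ω
    simp only [y]
    rw [norm_smul, Pi.norm_single, Pi.norm_single]
    simp only [s]
    split_ifs <;> simp
  have := hv y hym hy1
  refine le_trans (le_of_eq ?_) this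
  unfold pairB
  congr 1
  funext ω
  rw [ocp_dotB_comm]
  have : dotB (y ω) ((v : Ω → Fin (T+1) → Fin d → ℝ) ω) =
      s ω * (v : Ω → Fin (T+1) → Fin d → ℝ) ω t i := by
    rw [← ocp_dotB_single ((v : Ω → Fin (T+1) → Fin d → ℝ) ω) t i, ocp_dotB_comm _ (Pi.single _ _)]
    simp only [y, dotB, Pi.smul_apply, ocp_dotd_smul_left, Finset.mul_sum]
  rw [this]
  simp only [s]
  split_ifs with h
  · rw [abs_of_nonneg h, one_mul]
  · rw [abs_of_nonpos (not_le.1 h).le]; ring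

lemma ocp_ae_tendsto {Ω : Type} {mΩ : MeasurableSpace Ω} (P : Measure Ω) (g : ℕ → Ω → ℝ)
    (hg : ∀ n, Integrable (g n) P) (hb : ∀ n, ∫ ω, |g n ω| ∂P ≤ (1/2 : ℝ)^n) :
    ∀ᵐ ω ∂P, Filter.Tendsto (fun n => g n ω) Filter.atTop (nhds 0) := by
  have h1 : ∀ n, ∫⁻ ω, ‖g n ω‖ₑ ∂P ≤ (2⁻¹ : ℝ≥0∞)^n := by
    intro n
    rw [← ofReal_integral_norm_eq_lintegral_enorm (hg n)]
    refine (ENNReal.ofReal_le_ofReal (hb n)).trans (le_of_eq ?_)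
    rw [ENNReal.ofReal_pow (by norm_num), one_div, ENNReal.ofReal_inv_of_pos (by norm_num)]
    simp
  have hm : ∀ n, AEMeasurable (fun ω => ‖g n ω‖ₑ) P := fun n => (hg n).aestronglyMeasurable.enorm
  have h2 : ∫⁻ ω, ∑' n, ‖g n ω‖ₑ ∂P ≠ ⊤ := by
    rw [lintegral_tsum hm]
    refine ne_top_of_le_ne_top ?_ (ENNReal.tsum_le_tsum h1)
    rw [ENNReal.tsum_geometric]
    simp
  have h3 := ae_lt_top' (AEMeasurable.tsum hm) h2
  filter_upwards [h3] with ω hω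
  have := ENNReal.tendsto_atTop_zero_of_tsum_ne_top hω.ne
  rw [tendsto_zero_iff_norm_tendsto_zero]
  have h4 := (ENNReal.tendsto_toReal ENNReal.zero_ne_top).comp this
  simpa [Function.comp_def] using h4

lemma ocp_epos_comb {a b : ℝ} (ha : 0 ≤ a) (hb : 0 ≤ b) (p q r : EReal)
    (h : r ≤ (a : EReal) * p + (b : EReal) * q) :
    epos r ≤ ENNReal.ofReal a * epos p + ENNReal.ofReal b * epos q := by
  refine (ocp_epos_mono h).trans ?_
  simp only [ocp_epos_eq]
  refine EReal.toENNReal_add_le.trans ?_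
  rw [EReal.toENNReal_mul (by exact_mod_cast ha), EReal.toENNReal_mul (by exact_mod_cast hb)]
  simp

/-- The integral functional appearing in the bound of the value function. -/
def ocpG {Ω : Type} {mΩ : MeasurableSpace Ω} (P : Measure Ω)
    {T d : ℕ} (ℱ : Fin (T+1) → MeasurableSpace Ω) 
    (V : Fin (T+1) → (Fin d → ℝ) → Ω → EReal) (v : Ω → Fin (T+1) → Fin d → ℝ) : ℝ≥0∞ :=
  ∫⁻ ω, epos (V (Fin.last T) (∑ t, aProj P ℱ v ω t) ω) ∂P

lemma ocpG_meas {Ω : Type} {mΩ : MeasurableSpace Ω} (P : Measure Ω)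
    {T d : ℕ} (ℱ : Fin (T+1) → MeasurableSpace Ω) (C : Fin (T+1) → Ω → Set (Fin d → ℝ))
    (V : Fin (T+1) → (Fin d → ℝ) → Ω → EReal) (M : OcpMkt mΩ ℱ C V)
    (v : Ω → Fin (T+1) → Fin d → ℝ) :
    Measurable (fun ω => epos (V (Fin.last T) (∑ t, aProj P ℱ v ω t) ω)) := by
  refine Measurable.ereal_toENNReal ?_
  refine ocp_Vmeas (M.le _) _ (M.V_meas _) _ (Finset.measurable_fun_sum _ (fun t _ => ?_))
  exact (ocp_aProj_meas P ℱ v t).mono (M.le t) le_rfl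

lemma ocpG_convex {Ω : Type} {mΩ : MeasurableSpace Ω} (P : Measure Ω) [IsProbabilityMeasure P]
    {T d : ℕ} (ℱ : Fin (T+1) → MeasurableSpace Ω) (C : Fin (T+1) → Ω → Set (Fin d → ℝ))
    (V : Fin (T+1) → (Fin d → ℝ) → Ω → EReal) (M : OcpMkt mΩ ℱ C V)
    (v w : Ω → Fin (T+1) → Fin d → ℝ) (hv : ∀ t, Integrable (fun ω => v ω t) P)
    (hw : ∀ t, Integrable (fun ω => w ω t) P) (a b : ℝ) (ha : 0 < a) (hb : 0 < b)
    (hab : a + b = 1) :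
    ocpG P ℱ V (a • v + b • w) ≤ ENNReal.ofReal a * ocpG P ℱ V v + ENNReal.ofReal b * ocpG P ℱ V w := by
  unfold ocpG
  rw [← lintegral_const_mul _ (ocpG_meas P ℱ C V M v), ← lintegral_const_mul _ (ocpG_meas P ℱ C V M w),
    ← lintegral_add_left ((ocpG_meas P ℱ C V M v).const_mul _)]
  refine lintegral_mono_ae ?_
  filter_upwards [ocp_aProj_lin P ℱ v w hv hw a b] with ω hω
  refine ocp_epos_comb ha.le hb.le _ _ _ ?_
  refine le_trans (le_of_eq ?_) (M.V_convex (Fin.last T) ω a b _ _ ha hb hab)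
  rw [hω]
  congr 1
  simp only [Pi.add_apply, Pi.smul_apply, Finset.sum_add_distrib, Finset.smul_sum]

lemma ocpG_zero {Ω : Type} {mΩ : MeasurableSpace Ω} (P : Measure Ω) 
    {T d : ℕ} (ℱ : Fin (T+1) → MeasurableSpace Ω) (C : Fin (T+1) → Ω → Set (Fin d → ℝ))
    (V : Fin (T+1) → (Fin d → ℝ) → Ω → EReal) (M : OcpMkt mΩ ℱ C V) :
    ocpG P ℱ V 0 = 0 := by
  unfold ocpG
  have : ∀ ω t, aProj P ℱ (0 : Ω → Fin (T+1) → Fin d → ℝ) ω t = 0 := by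
    intro ω t
    unfold aProj
    have : (fun ω' : Ω => (0 : Ω → Fin (T+1) → Fin d → ℝ) ω' t) = 0 := rfl
    rw [this, condExp_zero]; rfl
  simp [this, M.V_zero, ocp_epos_eq]

lemma ocpG_fatou {Ω : Type} {mΩ : MeasurableSpace Ω} (P : Measure Ω) [IsProbabilityMeasure P]
    {T d : ℕ} (ℱ : Fin (T+1) → MeasurableSpace Ω) (C : Fin (T+1) → Ω → Set (Fin d → ℝ))
    (V : Fin (T+1) → (Fin d → ℝ) → Ω → EReal) (M : OcpMkt mΩ ℱ C V)
    (v : Ω → Fin (T+1) → Fin d → ℝ) (w : ℕ → Ω → Fin (T+1) → Fin d → ℝ)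
    (hv : ∀ t, Integrable (fun ω => v ω t) P)
    (hw : ∀ n t, Integrable (fun ω => w n ω t) P)
    (hb : ∀ n t i, ∫ ω, |w n ω t i - v ω t i| ∂P ≤ (1/2 : ℝ)^n)
    (h1 : ∀ n, ocpG P ℱ V (w n) ≤ 1) : ocpG P ℱ V v ≤ 1 := by
  have hconv : ∀ t i, ∀ᵐ ω ∂P, Filter.Tendsto (fun n => aProj P ℱ (w n) ω t i) Filter.atTop
      (nhds (aProj P ℱ v ω t i)) := by
    intro t i
    have hvc : Integrable (fun ω => v ω t i) P := (integrable_pi_iff.1 (hv t)) i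
    have hwc : ∀ n, Integrable (fun ω => w n ω t i) P := fun n => (integrable_pi_iff.1 (hw n t)) i
    have hk := ocp_ae_tendsto P (fun n => P[(fun ω => w n ω t i) - (fun ω => v ω t i) | ℱ t])
      (fun n => integrable_condExp)
      (fun n => (integral_abs_condExp_le _).trans (hb n t i))
    have hs : ∀ n, P[(fun ω => w n ω t i) - (fun ω => v ω t i) | ℱ t] =ᵐ[P]
        fun ω => aProj P ℱ (w n) ω t i - aProj P ℱ v ω t i := fun n =>
      (condExp_sub (hwc n) hvc (ℱ t)).trans
        ((ocp_aProj_comp P ℱ (w n) (hw n) t i).symm.sub (ocp_aProj_comp P ℱ v hv t i).symm)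
    filter_upwards [hk, ae_all_iff.2 hs] with ω h2 h3
    simp only [h3] at h2
    have := h2.add_const (aProj P ℱ v ω t i)
    simpa using this
  have hle : ∀ᵐ ω ∂P, epos (V (Fin.last T) (∑ t, aProj P ℱ v ω t) ω) ≤
      Filter.liminf (fun n => epos (V (Fin.last T) (∑ t, aProj P ℱ (w n) ω t) ω)) Filter.atTop := by
    filter_upwards [ae_all_iff.2 (fun t => ae_all_iff.2 (hconv t))] with ω hω
    have ht : Filter.Tendsto (fun n => ∑ t, aProj P ℱ (w n) ω t) Filter.atTop
        (nhds (∑ t, aProj P ℱ v ω t)) :=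
      tendsto_finsetSum _ (fun t _ => tendsto_pi_nhds.2 (fun i => hω t i))
    have hl : LowerSemicontinuous (EReal.toENNReal ∘ fun c => V (Fin.last T) c ω) :=
      EReal.continuous_toENNReal.comp_lowerSemicontinuous (M.V_lsc _ ω)
        (fun a b h => EReal.toENNReal_le_toENNReal h)
    have h4 := hl.le_liminf (∑ t, aProj P ℱ v ω t)
    refine h4.trans ?_
    have h5 := Filter.liminf_le_liminf_of_le
      (g := Filter.map (fun n => ∑ t, aProj P ℱ (w n) ω t) Filter.atTop) ht
      (u := EReal.toENNReal ∘ fun c => V (Fin.last T) c ω)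
    exact h5
  unfold ocpG
  refine (lintegral_mono_ae hle).trans ((lintegral_liminf_le
    (fun n => ocpG_meas P ℱ C V M (w n))).trans ?_)
  refine Filter.liminf_le_of_le (by isBoundedDefault) (fun b hb => ?_)
  obtain ⟨n, hn⟩ := hb.exists
  exact hn.trans (h1 n)

lemma ocpG_nhd {Ω : Type} {mΩ : MeasurableSpace Ω} (P : Measure Ω) [IsProbabilityMeasure P]
    {T d : ℕ} (ℱ : Fin (T+1) → MeasurableSpace Ω) (C : Fin (T+1) → Ω → Set (Fin d → ℝ))
    (V : Fin (T+1) → (Fin d → ℝ) → Ω → EReal) (M : OcpMkt mΩ ℱ C V)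
    (𝓤 : Submodule ℝ (Ω → Fin (T+1) → Fin d → ℝ))
    (h𝓤int : ∀ v ∈ 𝓤, ∀ t, Integrable (fun ω => v ω t) P)
    (τ : TopologicalSpace ↥𝓤)
    (hτ_grp : @IsTopologicalAddGroup ↥𝓤 τ _)
    (hτ_barrel : ∀ S : Set ↥𝓤, @IsClosed ↥𝓤 τ S → Convex ℝ S → Absorbent ℝ S →
      S ∈ @nhds ↥𝓤 τ 0)
    (hL1 : ∀ ε : ℝ, 0 < ε →
      {v : ↥𝓤 | ∀ t i, ∫ ω, |(v : Ω → Fin (T+1) → Fin d → ℝ) ω t i| ∂P ≤ ε} ∈ nhds (0 : ↥𝓤))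
    (hfin : ∀ v ∈ 𝓤, ocpG P ℱ V v ≠ ⊤) :
    {v : ↥𝓤 | ocpG P ℱ V (v : Ω → Fin (T+1) → Fin d → ℝ) ≤ 1} ∈ nhds (0 : ↥𝓤) := by
  set S : Set ↥𝓤 := {v : ↥𝓤 | ocpG P ℱ V (v : Ω → Fin (T+1) → Fin d → ℝ) ≤ 1} with hS
  apply hτ_barrel
  · refine isClosed_of_closure_subset (fun v hv => ?_)
    rw [mem_closure_iff_nhds] at hv
    have hex : ∀ n : ℕ, ∃ w : ↥𝓤, ocpG P ℱ V (w : Ω → Fin (T+1) → Fin d → ℝ) ≤ 1 ∧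
        ∀ t i, ∫ ω, |(w : Ω → Fin (T+1) → Fin d → ℝ) ω t i -
          (v : Ω → Fin (T+1) → Fin d → ℝ) ω t i| ∂P ≤ (1/2 : ℝ)^n := by
      intro n
      have hc : Continuous (fun w : ↥𝓤 => w - v) := continuous_sub_right v
      have hn := hc.continuousAt.preimage_mem_nhds (x := v) (t := {v : ↥𝓤 | ∀ t i,
        ∫ ω, |(v : Ω → Fin (T+1) → Fin d → ℝ) ω t i| ∂P ≤ (1/2 : ℝ)^n})
        (by rw [sub_self]; exact hL1 _ (by positivity))
      obtain ⟨w, hw1, hw2⟩ := hv _ hn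
      exact ⟨w, hw2, hw1⟩
    choose w hw1 hw2 using hex
    exact ocpG_fatou P ℱ C V M _ (fun n => (w n : Ω → Fin (T+1) → Fin d → ℝ)) (h𝓤int _ v.2)
      (fun n => h𝓤int _ (w n).2) hw2 hw1
  · rw [convex_iff_forall_pos]
    intro v hv w hw a b ha hb hab
    have := ocpG_convex P ℱ C V M v w (h𝓤int _ v.2) (h𝓤int _ w.2) a b ha hb hab
    refine this.trans ?_
    refine (add_le_add (mul_le_mul_right hv _) (mul_le_mul_right hw _)).trans (le_of_eq ?_)
    rw [mul_one, mul_one, ← ENNReal.ofReal_add ha.le hb.le, hab, ENNReal.ofReal_one]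
  · refine ocp_absorbent S (fun v => ?_)
    have hpos : ∀ w : ↥𝓤, ∀ a : ℝ, 0 < a → a < 1 → ocpG P ℱ V ((a • w : ↥𝓤) : Ω → Fin (T+1) → Fin d → ℝ)
        ≤ ENNReal.ofReal a * ocpG P ℱ V (w : Ω → Fin (T+1) → Fin d → ℝ) := by
      intro w a ha h1
      have := ocpG_convex P ℱ C V M w 0 (h𝓤int _ w.2) (fun t => integrable_zero _ _ _) a (1 - a) ha
        (by linarith) (by ring)
      rw [ocpG_zero P ℱ C V M, mul_zero, add_zero, smul_zero, add_zero] at this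
      exact this
    set K : ℝ := (ocpG P ℱ V (v : Ω → Fin (T+1) → Fin d → ℝ)).toReal +
      (ocpG P ℱ V ((-v : ↥𝓤) : Ω → Fin (T+1) → Fin d → ℝ)).toReal with hK
    have hK0 : 0 ≤ K := by positivity
    have hfinish : ∀ w : ↥𝓤, (ocpG P ℱ V (w : Ω → Fin (T+1) → Fin d → ℝ)).toReal ≤ K →
        ∀ a : ℝ, 0 < a → a < 1 / (K + 1) →
        ocpG P ℱ V ((a • w : ↥𝓤) : Ω → Fin (T+1) → Fin d → ℝ) ≤ 1 := by
      intro w hw a ha hlt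
      rw [lt_div_iff₀ (by linarith)] at hlt
      refine (hpos w a ha (by nlinarith)).trans ?_
      rw [← ENNReal.ofReal_toReal (hfin _ w.2), ← ENNReal.ofReal_mul ha.le, ← ENNReal.ofReal_one]
      apply ENNReal.ofReal_le_ofReal
      nlinarith
    refine ⟨1 / (K + 1), by positivity, fun a ha => ?_⟩
    rcases lt_trichotomy a 0 with h | h | h
    · rw [abs_of_neg h] at ha
      have := hfinish (-v) (by rw [hK]; linarith [ENNReal.toReal_nonneg (a := ocpG P ℱ V (v : Ω → Fin (T+1) → Fin d → ℝ))])
        (-a) (by linarith) ha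
      rwa [smul_neg, neg_smul, neg_neg] at this
    · subst h
      show ocpG P ℱ V (((0:ℝ) • v : ↥𝓤) : Ω → Fin (T+1) → Fin d → ℝ) ≤ 1
      rw [zero_smul, Submodule.coe_zero, ocpG_zero P ℱ C V M]
      exact zero_le
    · rw [abs_of_pos h] at ha
      exact hfinish v (by rw [hK]; linarith [ENNReal.toReal_nonneg (a := ocpG P ℱ V ((-v : ↥𝓤) : Ω → Fin (T+1) → Fin d → ℝ))]) a h ha

lemma ocp_EE_le {Ω : Type} {mΩ : MeasurableSpace Ω} (P : Measure Ω) (f : Ω → EReal) :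
    EE P f ≤ ((∫⁻ ω, epos (f ω) ∂P : ℝ≥0∞) : EReal) := by
  unfold EE
  split_ifs with h
  · rw [h]; simp
  · refine (EReal.sub_le_sub le_rfl (EReal.coe_ennreal_nonneg _)).trans ?_
    simp

lemma ocp_dual {Ω : Type} {mΩ : MeasurableSpace Ω} (P : Measure Ω) [IsProbabilityMeasure P]
    {T d : ℕ} (ℱ : Fin (T+1) → MeasurableSpace Ω) (C : Fin (T+1) → Ω → Set (Fin d → ℝ))
    (V : Fin (T+1) → (Fin d → ℝ) → Ω → EReal) (M : OcpMkt mΩ ℱ C V)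
    (𝓤 𝓨 : Submodule ℝ (Ω → Fin (T+1) → Fin d → ℝ))
    (h𝓤meas : ∀ u ∈ 𝓤, Measurable u)
    (h𝓤dec : DecomposableB P (𝓤 : Set (Ω → Fin (T+1) → Fin d → ℝ)))
    (h𝓨dec : DecomposableB P (𝓨 : Set (Ω → Fin (T+1) → Fin d → ℝ)))
    (hpair : ∀ u ∈ 𝓤, ∀ y ∈ 𝓨, Integrable (fun ω => dotB (u ω) (y ω)) P)
    (hproj𝓤 : ∀ u ∈ 𝓤, aProj P ℱ u ∈ 𝓤)
    (hproj𝓨 : ∀ y ∈ 𝓨, aProj P ℱ y ∈ 𝓨)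
    (τ : TopologicalSpace ↥𝓤)
    (hτ_grp : @IsTopologicalAddGroup ↥𝓤 τ _)
    (hτ_smul : @ContinuousSMul ℝ ↥𝓤 _ _ τ)
    (hτ_barrel : ∀ S : Set ↥𝓤, @IsClosed ↥𝓤 τ S → Convex ℝ S → Absorbent ℝ S →
      S ∈ @nhds ↥𝓤 τ 0)
    (hτ_compat : ∀ g : ↥𝓤 →ₗ[ℝ] ℝ, (@Continuous ↥𝓤 ℝ τ _ g) ↔
      ∃ y ∈ 𝓨, ∀ u : ↥𝓤, g u = pairB P (u : Ω → Fin (T+1) → Fin d → ℝ) y)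
    (hφ_proper : ∀ u ∈ 𝓤, phiOCP P C V ℱ u ≠ ⊥)
    (θ : (Fin (T+1) → Fin d → ℝ) → Ω → EReal)
    (hEθ_fin : ∀ u ∈ 𝓤, ∃ r : ℝ, EE P (fun ω => θ (u ω) ω) = (r : EReal))
    (hθ_bound : ∀ (u : Fin (T+1) → Fin d → ℝ) (ω : Ω),
      V (Fin.last T) (∑ t, u t) ω ≤ θ u ω)
    (u : Ω → Fin (T+1) → Fin d → ℝ) (hu : u ∈ 𝓤)
    (hu_adapted : ∀ t, Measurable[ℱ t] (fun ω => u ω t)) :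
    ∃ Y, Y ∈ 𝓨 ∧ (∀ t, Measurable[ℱ t] (fun ω => Y ω t)) ∧
      (∀ t, Integrable (fun ω => Y ω t) P) ∧
      ∃ r : ℝ, phiOCP P C V ℱ u = (r : EReal) ∧
      ∀ δ : Ω → Fin (T+1) → Fin d → ℝ, (∀ t, Measurable[ℱ t] (fun ω => δ ω t)) →
        ∀ K : ℝ, (∀ ω, ‖δ ω‖ ≤ K) →
        ((r + pairB P δ Y : ℝ) : EReal) ≤ phiOCP P C V ℱ (u + δ) := by
  have h𝓤int : ∀ v ∈ 𝓤, ∀ t, Integrable (fun ω => v ω t) P := fun v hv t =>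
    integrable_pi_iff.2 (fun i => ocp_int_comp P 𝓤 𝓨 h𝓨dec hpair v hv t i)
  have h𝓨int : ∀ v ∈ 𝓨, ∀ t, Integrable (fun ω => v ω t) P := fun v hv t =>
    integrable_pi_iff.2 (fun i => ocp_int_comp P 𝓨 𝓤 h𝓤dec
      (fun y hy w hw => by simpa only [ocp_dotB_comm] using hpair w hw y hy) v hv t i)
  have hle1 : ∀ v ∈ 𝓤, phiOCP P C V ℱ (aProj P ℱ v) ≤
      EE P (fun ω => V (Fin.last T) (∑ t, aProj P ℱ v ω t) ω) := fun v hv =>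
    ocp_phi_le_VT P ℱ C V M _ (ocp_aProj_meas P ℱ v)
  have hfinφ : ∀ v ∈ 𝓤, phiOCP P C V ℱ (aProj P ℱ v) =
      (((phiOCP P C V ℱ (aProj P ℱ v)).toReal : ℝ) : EReal) := by
    intro v hv
    refine (EReal.coe_toReal ?_ (hφ_proper _ (hproj𝓤 v hv))).symm
    obtain ⟨r, hr⟩ := hEθ_fin _ (hproj𝓤 v hv)
    refine ne_top_of_le_ne_top (EReal.coe_ne_top r) ((hle1 v hv).trans ?_)
    rw [← hr]
    exact ocp_EE_mono P _ _ (Filter.Eventually.of_forall (fun ω => hθ_bound _ ω))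
  have hGfin : ∀ v ∈ 𝓤, ocpG P ℱ V v ≠ ⊤ := by
    intro v hv
    obtain ⟨r, hr⟩ := hEθ_fin _ (hproj𝓤 v hv)
    have h1 : ∫⁻ ω, epos (θ (aProj P ℱ v ω) ω) ∂P ≠ ⊤ := by
      intro h
      unfold EE at hr
      rw [if_pos h] at hr
      exact EReal.coe_ne_top r hr.symm
    refine ne_top_of_le_ne_top h1 (lintegral_mono (fun ω => ocp_epos_mono (hθ_bound _ ω)))
  let h : ↥𝓤 → ℝ := fun v => (phiOCP P C V ℱ (aProj P ℱ (v : Ω → Fin (T+1) → Fin d → ℝ))).toReal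
  have hφh : ∀ v : ↥𝓤, phiOCP P C V ℱ (aProj P ℱ (v : Ω → Fin (T+1) → Fin d → ℝ)) = (h v : EReal) :=
    fun v => hfinφ v v.2
  have hconv : ∀ (a b : ℝ) (v w : ↥𝓤), 0 < a → 0 < b → a + b = 1 →
      h (a • v + b • w) ≤ a * h v + b * h w := by
    intro a b v w ha hb hab
    have := ocp_phi_convex P ℱ C V M _ _ (h𝓤meas _ (hproj𝓤 _ v.2)) (h𝓤meas _ (hproj𝓤 _ w.2))
      (h v) (h w) (hφh v) (hφh w) a b ha hb hab
    rw [← ocp_phi_congr P ℱ C V _ _ (ocp_aProj_lin P ℱ v w (h𝓤int _ v.2) (h𝓤int _ w.2) a b)] at this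
    have e := hφh (a • v + b • w)
    have e2 : phiOCP P C V ℱ (aProj P ℱ (a • (v : Ω → Fin (T+1) → Fin d → ℝ) + b • w)) =
      (h (a • v + b • w) : EReal) := e
    rw [e2, EReal.coe_le_coe_iff] at this
    exact this
  obtain ⟨f, hf⟩ := ocp_subgrad h hconv ⟨u, hu⟩
  have hS := ocpG_nhd P ℱ C V M 𝓤 h𝓤int τ hτ_grp hτ_barrel
    (fun ε hε => ocp_L1nhd P 𝓤 𝓨 h𝓤meas h𝓨dec hpair τ hτ_barrel hτ_compat ε hε) hGfin
  have hfc : Continuous f := by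
    refine ocp_cont f _ hS (1 - h ⟨u, hu⟩ + f ⟨u, hu⟩) (fun v hv => ?_)
    have h1 := hf (v - ⟨u, hu⟩)
    rw [add_sub_cancel, map_sub] at h1
    have h2 : h v ≤ 1 := by
      have h3 := (hle1 v v.2).trans (ocp_EE_le P _)
      rw [hφh v] at h3
      have h4 : ((ocpG P ℱ V (v : Ω → Fin (T+1) → Fin d → ℝ) : ℝ≥0∞) : EReal) ≤ ((1 : ℝ≥0∞) : EReal) := by
        exact_mod_cast hv
      have h5 := h3.trans h4
      rw [EReal.coe_ennreal_one, ← EReal.coe_one, EReal.coe_le_coe_iff] at h5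
      exact h5
    linarith
  obtain ⟨y, hy, hfy⟩ := (hτ_compat f).1 hfc
  have hau : aProj P ℱ u = u := ocp_aProj_adapted P ℱ M.le u (h𝓤int u hu) hu_adapted
  have hru : phiOCP P C V ℱ u = (h ⟨u, hu⟩ : EReal) := by
    have := hφh ⟨u, hu⟩
    simp only [hau] at this
    exact this
  refine ⟨aProj P ℱ y, hproj𝓨 y hy, ocp_aProj_meas P ℱ y, h𝓨int _ (hproj𝓨 y hy), h ⟨u, hu⟩, hru, ?_⟩
  intro δ hδ K hK
  have hδm : Measurable δ := measurable_pi_iff.2 (fun t => (hδ t).mono (M.le t) le_rfl)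
  have hδU : δ ∈ 𝓤 := ocp_bdd_mem P 𝓤 h𝓤dec δ hδm K hK
  rw [← ocp_pair_proj P ℱ M.le δ y (h𝓨int y hy) hδ K hK]
  have h1 := hf ⟨δ, hδU⟩
  rw [hfy] at h1
  have hau2 : aProj P ℱ (u + δ) = u + δ := ocp_aProj_adapted P ℱ M.le _
    (h𝓤int _ (𝓤.add_mem hu hδU)) (fun t => (hu_adapted t).add (hδ t))
  have h2 := hφh (⟨u, hu⟩ + ⟨δ, hδU⟩)
  have h3 : phiOCP P C V ℱ (aProj P ℱ (u + δ)) = (h (⟨u, hu⟩ + ⟨δ, hδU⟩) : EReal) := h2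
  rw [hau2] at h3
  rw [h3, EReal.coe_le_coe_iff]
  exact h1

/-! ### Necessity -/

def OcpPert {Ω : Type} {mΩ : MeasurableSpace Ω} (P : Measure Ω)
    {T d : ℕ} (ℱ : Fin (T+1) → MeasurableSpace Ω) (C : Fin (T+1) → Ω → Set (Fin d → ℝ))
    (V : Fin (T+1) → (Fin d → ℝ) → Ω → EReal)
    (x : (Ω → Fin (T+1) → Fin d → ℝ) × (Ω → Fin (T+1) → Fin d → ℝ))
    (u Y : Ω → Fin (T+1) → Fin d → ℝ) : Prop :=
  ∀ x' ∈ NOCP d ℱ, ∀ δ : Ω → Fin (T+1) → Fin d → ℝ, (∀ t, Measurable[ℱ t] (fun ω => δ ω t)) →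
    ∀ K : ℝ, (∀ ω, ‖δ ω‖ ≤ K) → ∀ R : Ω → ℝ, Integrable R P →
    (∀ᵐ ω ∂P, fOCP C V (x'.1 ω) (x'.2 ω) (u ω + δ ω) ω ≤
      ((∑ t, (V t (-(x.2 ω t)) ω).toReal + R ω : ℝ) : EReal)) → pairB P δ Y ≤ ∫ ω, R ω ∂P

def OcpFeas {Ω : Type} {mΩ : MeasurableSpace Ω} (P : Measure Ω)
    {T d : ℕ} (C : Fin (T+1) → Ω → Set (Fin d → ℝ))
    (V : Fin (T+1) → (Fin d → ℝ) → Ω → EReal)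
    (x : (Ω → Fin (T+1) → Fin d → ℝ) × (Ω → Fin (T+1) → Fin d → ℝ))
    (u : Ω → Fin (T+1) → Fin d → ℝ) : Prop :=
  ∀ᵐ ω ∂P, (∀ t, deltaX (x.1 ω) t + u ω t + x.2 ω t ∈ C t ω) ∧ x.1 ω (Fin.last T) = 0 ∧
    (∀ t, V t (-(x.2 ω t)) ω = (((V t (-(x.2 ω t)) ω).toReal : ℝ) : EReal))

lemma ocp_pert {Ω : Type} {mΩ : MeasurableSpace Ω} (P : Measure Ω) [IsProbabilityMeasure P]
    {T d : ℕ} (ℱ : Fin (T+1) → MeasurableSpace Ω) (C : Fin (T+1) → Ω → Set (Fin d → ℝ))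
    (V : Fin (T+1) → (Fin d → ℝ) → Ω → EReal) (M : OcpMkt mΩ ℱ C V)
    (x : (Ω → Fin (T+1) → Fin d → ℝ) × (Ω → Fin (T+1) → Fin d → ℝ)) (hx : x ∈ NOCP d ℱ)
    (u Y : Ω → Fin (T+1) → Fin d → ℝ) (hum : Measurable u) (r : ℝ)
    (hxr : intOCP P C V x u = (r : EReal))
    (hY : ∀ δ : Ω → Fin (T+1) → Fin d → ℝ, (∀ t, Measurable[ℱ t] (fun ω => δ ω t)) →
        ∀ K : ℝ, (∀ ω, ‖δ ω‖ ≤ K) →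
        ((r + pairB P δ Y : ℝ) : EReal) ≤ phiOCP P C V ℱ (u + δ)) :
    OcpPert P ℱ C V x u Y ∧ OcpFeas P C V x u := by
  have hm := ocp_f_meas ℱ M.le M.mono C M.C_meas M.C_closed M.C_zero V M.V_meas x hx u hum
  obtain ⟨F, hF, hfF, hE⟩ := ocp_EE_fin P _ hm
    (by change intOCP P C V x u ≠ ⊤; rw [hxr]; exact EReal.coe_ne_top _)
    (by change intOCP P C V x u ≠ ⊥; rw [hxr]; exact EReal.coe_ne_bot _)
  change intOCP P C V x u = _ at hE
  have hrF : r = ∫ ω, F ω ∂P := by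
    rw [hxr] at hE; exact_mod_cast hE
  have hfin : ∀ᵐ ω ∂P, _ := hfF.mono (fun ω hω =>
    ocp_f_fin C V (x.1 ω) (x.2 ω) (u ω) ω (fun t c => M.V_proper t ω c) (F ω) hω)
  constructor
  · intro x' hx' δ hδ K hK R hR hle
    have h1 := hY δ hδ K hK
    have h2 : phiOCP P C V ℱ (u + δ) ≤ intOCP P C V x' (u + δ) := iInf₂_le x' hx'
    have h3 : intOCP P C V x' (u + δ) ≤ EE P (fun ω => ((F ω + R ω : ℝ) : EReal)) := by
      refine ocp_EE_mono P _ _ ?_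
      filter_upwards [hle, hfin] with ω h1 h2
      rw [h2.2.2.2]; exact h1
    rw [ocp_EE_real P (fun ω => F ω + R ω) (hF.add hR)] at h3
    have h4 := (h1.trans h2).trans h3
    rw [EReal.coe_le_coe_iff, integral_add hF hR] at h4
    linarith
  · exact hfin.mono (fun ω h => ⟨h.1, h.2.1, h.2.2.1⟩)

lemma ocp_deltaX_norm {T d : ℕ} (x : Fin (T+1) → Fin d → ℝ) (t : Fin (T+1)) :
    ‖deltaX x t‖ ≤ 2 * ‖x‖ := by
  unfold deltaX
  refine (norm_sub_le _ _).trans ?_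
  have h1 := norm_le_pi_norm x t
  split_ifs
  · simp only [norm_zero]; linarith [norm_nonneg x]
  · linarith [norm_le_pi_norm x ⟨(t : ℕ) - 1, Nat.lt_of_le_of_lt (Nat.sub_le _ _) t.isLt⟩]

lemma ocp_nec_mart {Ω : Type} {mΩ : MeasurableSpace Ω} (P : Measure Ω) [IsProbabilityMeasure P]
    {T d : ℕ} (ℱ : Fin (T+1) → MeasurableSpace Ω) (C : Fin (T+1) → Ω → Set (Fin d → ℝ))
    (V : Fin (T+1) → (Fin d → ℝ) → Ω → EReal) (M : OcpMkt mΩ ℱ C V)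
    (x : (Ω → Fin (T+1) → Fin d → ℝ) × (Ω → Fin (T+1) → Fin d → ℝ)) (hx : x ∈ NOCP d ℱ)
    (u Y : Ω → Fin (T+1) → Fin d → ℝ) (hYi : ∀ t, Integrable (fun ω => Y ω t) P)
    (hp : OcpPert P ℱ C V x u Y) (hf : OcpFeas P C V x u)
    (t : Fin (T+1)) (ht : (t : ℕ) < T) (A : Set Ω) (hA : MeasurableSet[ℱ t] A) :
    ∫ ω in A, Y ω ⟨(t : ℕ) + 1, Nat.succ_lt_succ ht⟩ ∂P = ∫ ω in A, Y ω t ∂P := by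
  classical
  have key : ∀ (a : ℝ) (i : Fin d),
      a * ((∫ ω in A, Y ω ⟨(t : ℕ) + 1, Nat.succ_lt_succ ht⟩ i ∂P) - ∫ ω in A, Y ω t i ∂P) ≤ 0 := by
    intro a i
    set w : Fin (T+1) → Fin d → ℝ := Pi.single t (Pi.single i a) with hw
    set ζ : Ω → Fin (T+1) → Fin d → ℝ := A.indicator (fun _ => w) with hζ
    have hζm : ∀ s, Measurable[ℱ s] (fun ω => ζ ω s) := by
      intro s
      have e : (fun ω => ζ ω s) = A.indicator (fun _ => w s) := by
        funext ω; simp only [hζ, Set.indicator]; split_ifs <;> rfl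
      rw [e]
      by_cases hs : s = t
      · subst hs; exact measurable_const.indicator hA
      · have : w s = 0 := by rw [hw, Pi.single_eq_of_ne hs]
        rw [this]
        simp only [Set.indicator_zero]
        exact measurable_const
    have hζb : ∀ ω, ‖ζ ω‖ ≤ ‖w‖ := fun ω => norm_indicator_le_norm_self _ ω
    have h1 := hp (x.1 + ζ, x.2) ⟨fun s => (hx.1 s).add (hζm s), hx.2⟩
      (fun ω => fun s => - deltaX (ζ ω) s)
      (fun s => (ocp_deltaX_meas ℱ M.mono ζ hζm s).neg) (2 * ‖w‖) (fun ω => by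
        refine (pi_norm_le_iff_of_nonneg (by positivity)).2 (fun s => ?_)
        rw [norm_neg]
        exact (ocp_deltaX_norm _ _).trans (by linarith [hζb ω])) (fun _ => 0) (integrable_zero _ _ _) ?_
    · have e1 : ∀ ω, dotB (fun s => - deltaX (ζ ω) s) (Y ω) = A.indicator (fun ω =>
          a * (Y ω ⟨(t : ℕ) + 1, Nat.succ_lt_succ ht⟩ i - Y ω t i)) ω := by
        intro ω
        have e2 : dotB (fun s => - deltaX (ζ ω) s) (Y ω) = ∑ s, dotd (ζ ω s) (deltaNext (Y ω) s) := by
          have := ocp_abel (ζ ω) (Y ω)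
          unfold dotB
          simp only [ocp_dotd_neg_left, Finset.sum_neg_distrib]
          rw [this, neg_neg]
        rw [e2]
        by_cases hω : ω ∈ A
        · simp only [hζ, Set.indicator_of_mem hω]
          rw [Finset.sum_eq_single t]
          · have : ((t : ℕ) = T) ↔ False := by simp; omega
            simp only [hw, Pi.single_eq_same, dotd, deltaNext, this, dif_neg, not_false_eq_true]
            rw [Finset.sum_eq_single i]
            · simp
            · intro j _ hj; simp [Pi.single_eq_of_ne hj]
            · simp
          · intro s _ hs
            rw [hw, Pi.single_eq_of_ne hs, ocp_dotd_zero_left]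
          · simp
        · simp only [hζ, Set.indicator_of_notMem hω]
          simp [dotd]
      unfold pairB at h1
      simp only [e1] at h1
      rw [integral_indicator (M.le t _ hA), integral_const_mul, integral_sub
        (integrable_pi_iff.1 (hYi _) i).integrableOn (integrable_pi_iff.1 (hYi _) i).integrableOn,
        integral_zero] at h1
      exact h1
    · filter_upwards [hf] with ω hω
      obtain ⟨h1, h2, h3⟩ := hω
      rw [ocp_f_of]
      · rw [add_zero, ocp_coe_sum]
        exact (Finset.sum_congr rfl (fun s _ => h3 s)).le
      · intro s
        have e := ocp_deltaX_lin 1 1 (x.1 ω) (ζ ω) s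
        simp only [one_smul] at e
        have : deltaX ((x.1 + ζ) ω) s + (u ω + fun s => - deltaX (ζ ω) s) s + x.2 ω s
          = deltaX (x.1 ω) s + u ω s + x.2 ω s := by
          rw [Pi.add_apply, e, Pi.add_apply]; abel
        rw [this]; exact h1 s
      · have : ζ ω (Fin.last T) = 0 := by
          have hne : Fin.last T ≠ t := by
            intro h; rw [← h] at ht; simp at ht
          simp only [hζ, Set.indicator]
          split_ifs
          · rw [hw, Pi.single_eq_of_ne hne]
          · rfl
        simp only [Pi.add_apply]
        rw [h2, this, add_zero]
  funext i
  rw [eval_integral (fun i => (integrable_pi_iff.1 (hYi _) i).integrableOn),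
    eval_integral (fun i => (integrable_pi_iff.1 (hYi _) i).integrableOn)]
  have h1 := key 1 i
  have h2 := key (-1) i
  linarith

lemma ocp_pert_single {Ω : Type} {mΩ : MeasurableSpace Ω} (P : Measure Ω) [IsProbabilityMeasure P]
    {T d : ℕ} (ℱ : Fin (T+1) → MeasurableSpace Ω) (C : Fin (T+1) → Ω → Set (Fin d → ℝ))
    (V : Fin (T+1) → (Fin d → ℝ) → Ω → EReal)
    (x : (Ω → Fin (T+1) → Fin d → ℝ) × (Ω → Fin (T+1) → Fin d → ℝ)) (hx : x ∈ NOCP d ℱ)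
    (u Y : Ω → Fin (T+1) → Fin d → ℝ)
    (hp : OcpPert P ℱ C V x u Y) (hf : OcpFeas P C V x u)
    (t : Fin (T+1)) (g a : Ω → Fin d → ℝ) (hg : Measurable[ℱ t] g) (ha : Measurable[ℱ t] a)
    (K : ℝ) (hK : ∀ ω, ‖g ω‖ ≤ K) (R : Ω → ℝ) (hR : Integrable R P)
    (h1 : ∀ᵐ ω ∂P, deltaX (x.1 ω) t + u ω t + x.2 ω t + (a ω + g ω) ∈ C t ω)
    (h2 : ∀ᵐ ω ∂P, V t (-(x.2 ω t + a ω)) ω ≤ (((V t (-(x.2 ω t)) ω).toReal + R ω : ℝ) : EReal)) :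
    ∫ ω, dotd (g ω) (Y ω t) ∂P ≤ ∫ ω, R ω ∂P := by
  classical
  have hsm : ∀ (b : Ω → Fin d → ℝ), Measurable[ℱ t] b → ∀ s, Measurable[ℱ s] (fun ω =>
      (Pi.single t (b ω) : Fin (T+1) → Fin d → ℝ) s) := by
    intro b hb s
    by_cases hs : s = t
    · subst hs; simpa using hb
    · simp only [Pi.single_eq_of_ne hs]; exact measurable_const
  have h := hp (x.1, x.2 + fun ω => Pi.single t (a ω)) ⟨hx.1, fun s => (hx.2 s).add (hsm a ha s)⟩
    (fun ω => Pi.single t (g ω)) (hsm g hg) K (fun ω => by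
      refine (pi_norm_le_iff_of_nonneg ((norm_nonneg _).trans (hK ω))).2 (fun s => ?_)
      by_cases hs : s = t
      · subst hs; simpa using hK ω
      · rw [Pi.single_eq_of_ne hs, norm_zero]; exact ((norm_nonneg _).trans (hK ω))) R hR ?_
  · unfold pairB at h
    have e : ∀ ω, dotB (Pi.single t (g ω)) (Y ω) = dotd (g ω) (Y ω t) := by
      intro ω
      unfold dotB
      rw [Finset.sum_eq_single t]
      · simp
      · intro s _ hs; rw [Pi.single_eq_of_ne hs, ocp_dotd_zero_left]
      · simp
    simp only [e] at h
    exact h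
  · filter_upwards [hf, h1, h2] with ω hω h1 h2
    obtain ⟨f1, f2, f3⟩ := hω
    rw [ocp_f_of]
    · have e : (∑ t, (V t (-(x.2 ω t)) ω).toReal + R ω : ℝ) =
        ∑ s, ((V s (-(x.2 ω s)) ω).toReal + if s = t then R ω else 0) := by
        rw [Finset.sum_add_distrib]; simp
      rw [e, ocp_coe_sum]
      refine Finset.sum_le_sum (fun s _ => ?_)
      by_cases hs : s = t
      · subst hs; simpa using h2
      · simp only [Pi.add_apply, Pi.single_eq_of_ne hs, add_zero, hs, if_false]
        exact (f3 s).le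
    · intro s
      by_cases hs : s = t
      · subst hs
        have e : deltaX (x.1 ω) s + (u ω s + g ω) + (x.2 ω s + a ω)
            = deltaX (x.1 ω) s + u ω s + x.2 ω s + (a ω + g ω) := by abel
        simp only [Pi.add_apply, Pi.single_eq_same]
        rw [e]; exact h1
      · simp only [Pi.add_apply, Pi.single_eq_of_ne hs, add_zero]
        exact f1 s
    · exact f2

lemma ocp_null {Ω : Type} {mΩ : MeasurableSpace Ω} (P : Measure Ω)
    (B : Set Ω) (h : Ω → ℝ) (hi : Integrable (B.indicator h) P)
    (hpos : ∀ ω ∈ B, 0 < h ω) (hle : ∫ ω, B.indicator h ω ∂P ≤ 0) : ∀ᵐ ω ∂P, ω ∉ B := by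
  have h0 : 0 ≤ B.indicator h := Set.indicator_nonneg (fun ω hω => (hpos ω hω).le)
  have h1 := (integral_eq_zero_iff_of_nonneg h0 hi).1 (le_antisymm hle (integral_nonneg h0))
  filter_upwards [h1] with ω hω hB
  rw [Set.indicator_of_mem hB] at hω
  exact (hpos ω hB).ne' hω

lemma ocp_nec_core {Ω : Type} {mΩ : MeasurableSpace Ω} (P : Measure Ω) [IsProbabilityMeasure P]
    {T d : ℕ} (ℱ : Fin (T+1) → MeasurableSpace Ω) (C : Fin (T+1) → Ω → Set (Fin d → ℝ))
    (V : Fin (T+1) → (Fin d → ℝ) → Ω → EReal) (M : OcpMkt mΩ ℱ C V)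
    (x : (Ω → Fin (T+1) → Fin d → ℝ) × (Ω → Fin (T+1) → Fin d → ℝ)) (hx : x ∈ NOCP d ℱ)
    (u Y : Ω → Fin (T+1) → Fin d → ℝ)
    (hYi : ∀ t, Integrable (fun ω => Y ω t) P)
    (hYm : ∀ t, Measurable[ℱ t] (fun ω => Y ω t))
    (hp : OcpPert P ℱ C V x u Y) (hf : OcpFeas P C V x u)
    (t : Fin (T+1)) (g a : Ω → Fin d → ℝ) (hg : Measurable[ℱ t] g) (ha : Measurable[ℱ t] a)
    (R : Ω → ℝ) (hR : Measurable[ℱ t] R) (D : Set Ω) (hD : MeasurableSet[ℱ t] D)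
    (h1 : ∀ᵐ ω ∂P, ω ∈ D → deltaX (x.1 ω) t + u ω t + x.2 ω t + (a ω + g ω) ∈ C t ω)
    (h2 : ∀ᵐ ω ∂P, ω ∈ D → V t (-(x.2 ω t + a ω)) ω ≤
      (((V t (-(x.2 ω t)) ω).toReal + R ω : ℝ) : EReal)) :
    ∀ᵐ ω ∂P, ω ∈ D → dotd (g ω) (Y ω t) ≤ R ω := by
  have hdot : Measurable[ℱ t] (fun ω => dotd (g ω) (Y ω t)) := by
    unfold dotd
    refine Finset.measurable_sum _ (fun i _ => ?_)
    exact (((measurable_pi_apply i).comp hg)).mul ((measurable_pi_apply i).comp (hYm t))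
  have key : ∀ n : ℕ, ∀ᵐ ω ∂P, ω ∉ {ω | ω ∈ D ∧ ‖g ω‖ ≤ n ∧ |R ω| ≤ n ∧
      R ω < dotd (g ω) (Y ω t)} := by
    intro n
    set B : Set Ω := {ω | ω ∈ D ∧ ‖g ω‖ ≤ n ∧ |R ω| ≤ n ∧ R ω < dotd (g ω) (Y ω t)} with hB
    have hBm : MeasurableSet[ℱ t] B := by
      refine MeasurableSet.inter hD (MeasurableSet.inter ?_ (MeasurableSet.inter ?_ ?_))
      · exact measurableSet_le (continuous_norm.measurable.comp hg) measurable_const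
      · exact measurableSet_le (continuous_abs.measurable.comp hR) measurable_const
      · exact measurableSet_lt hR hdot
    have hBm' := M.le t _ hBm
    have hgb : ∀ ω, ‖B.indicator g ω‖ ≤ n := by
      intro ω
      by_cases hω : ω ∈ B
      · rw [Set.indicator_of_mem hω]; exact hω.2.1
      · rw [Set.indicator_of_notMem hω]; simp
    have hRi : Integrable (B.indicator R) P := by
      refine Integrable.of_bound ((hR.mono (M.le t) le_rfl).indicator hBm').aestronglyMeasurable n
        (Filter.Eventually.of_forall (fun ω => ?_))
      by_cases hω : ω ∈ B
      · rw [Set.indicator_of_mem hω]; exact hω.2.2.1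
      · rw [Set.indicator_of_notMem hω]; simp
    have h := ocp_pert_single P ℱ C V x hx u Y hp hf t (B.indicator g) (B.indicator a)
      (hg.indicator hBm) (ha.indicator hBm) n hgb (B.indicator R) hRi
      (by
        filter_upwards [hf, h1] with ω h0 h1
        by_cases hω : ω ∈ B
        · simp only [Set.indicator_of_mem hω]; exact h1 hω.1
        · simp only [Set.indicator_of_notMem hω, add_zero]; exact h0.1 t)
      (by
        filter_upwards [hf, h2] with ω h0 h1
        by_cases hω : ω ∈ B
        · simp only [Set.indicator_of_mem hω]; exact h1 hω.1
        · simp only [Set.indicator_of_notMem hω, add_zero]; exact (h0.2.2 t).le)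
    have hdi : Integrable (fun ω => dotd (B.indicator g ω) (Y ω t)) P := by
      unfold dotd
      refine integrable_finsetSum _ (fun i _ => ?_)
      refine (integrable_pi_iff.1 (hYi t) i).bdd_mul (c := (n:ℝ))
        ((measurable_pi_apply i).comp ((hg.mono (M.le t) le_rfl).indicator hBm')).aestronglyMeasurable
        (Filter.Eventually.of_forall (fun ω => ?_))
      exact (norm_le_pi_norm _ i).trans (hgb ω)
    have e : B.indicator (fun ω => dotd (g ω) (Y ω t) - R ω) =
        fun ω => dotd (B.indicator g ω) (Y ω t) - B.indicator R ω := by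
      funext ω
      by_cases hω : ω ∈ B
      · simp only [Set.indicator_of_mem hω]
      · simp only [Set.indicator_of_notMem hω, ocp_dotd_zero_left, sub_zero]
    refine ocp_null P B (fun ω => dotd (g ω) (Y ω t) - R ω) ?_ ?_ ?_
    · rw [e]; exact hdi.sub hRi
    · intro ω hω; have := hω.2.2.2; linarith
    · rw [e, integral_sub hdi hRi]; linarith
  filter_upwards [ae_all_iff.2 key] with ω hω hD
  by_contra hlt
  obtain ⟨n, hn⟩ := exists_nat_ge (max ‖g ω‖ |R ω|)
  exact hω n ⟨hD, (le_max_left _ _).trans hn, (le_max_right _ _).trans hn, not_le.1 hlt⟩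

lemma ocp_nec_C {Ω : Type} {mΩ : MeasurableSpace Ω} (P : Measure Ω) [IsProbabilityMeasure P]
    {T d : ℕ} (ℱ : Fin (T+1) → MeasurableSpace Ω) (C : Fin (T+1) → Ω → Set (Fin d → ℝ))
    (V : Fin (T+1) → (Fin d → ℝ) → Ω → EReal) (M : OcpMkt mΩ ℱ C V)
    (x : (Ω → Fin (T+1) → Fin d → ℝ) × (Ω → Fin (T+1) → Fin d → ℝ)) (hx : x ∈ NOCP d ℱ)
    (u Y : Ω → Fin (T+1) → Fin d → ℝ)
    (hum : ∀ t, Measurable[ℱ t] (fun ω => u ω t))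
    (hYi : ∀ t, Integrable (fun ω => Y ω t) P)
    (hYm : ∀ t, Measurable[ℱ t] (fun ω => Y ω t))
    (hp : OcpPert P ℱ C V x u Y) (hf : OcpFeas P C V x u)
    (t : Fin (T+1)) :
    ∀ᵐ ω ∂P, ∀ c ∈ C t ω, dotd c (Y ω t) ≤ dotd (deltaX (x.1 ω) t + u ω t + x.2 ω t) (Y ω t) := by
  obtain ⟨p, hpm, hpC, hpd⟩ := @ocp_castaing Ω (ℱ t) d (C t) (M.C_meas t) (M.C_closed t) (M.C_zero t)
  have hc : Measurable[ℱ t] (fun ω => deltaX (x.1 ω) t + u ω t + x.2 ω t) :=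
    ((ocp_deltaX_meas ℱ M.mono x.1 hx.1 t).add (hum t)).add (hx.2 t)
  have key : ∀ i j, ∀ᵐ ω ∂P, dotd (p i j ω) (Y ω t) ≤
      dotd (deltaX (x.1 ω) t + u ω t + x.2 ω t) (Y ω t) := by
    intro i j
    have h := ocp_nec_core P ℱ C V M x hx u Y hYi hYm hp hf t
      (fun ω => p i j ω - (deltaX (x.1 ω) t + u ω t + x.2 ω t)) (fun _ => 0)
      ((hpm i j).sub hc) measurable_const (fun _ => 0) measurable_const Set.univ MeasurableSet.univ
      (Filter.Eventually.of_forall (fun ω _ => by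
        rw [zero_add, add_sub_cancel]; exact hpC i j ω))
      (by
        filter_upwards [hf] with ω h0 _
        rw [add_zero, add_zero]; exact (h0.2.2 t).le)
    filter_upwards [h] with ω h
    have := h trivial
    rw [ocp_dotd_sub_left] at this
    linarith
  filter_upwards [ae_all_iff.2 (fun i => ae_all_iff.2 (key i))] with ω hω c hc
  have hcl : IsClosed {c : Fin d → ℝ | dotd c (Y ω t) ≤
      dotd (deltaX (x.1 ω) t + u ω t + x.2 ω t) (Y ω t)} :=
    isClosed_le (ocp_dotd_cont _) continuous_const
  have : c ∈ closure {c : Fin d → ℝ | dotd c (Y ω t) ≤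
      dotd (deltaX (x.1 ω) t + u ω t + x.2 ω t) (Y ω t)} := by
    refine Metric.mem_closure_iff.2 (fun ε hε => ?_)
    obtain ⟨i, j, hij⟩ := hpd ω c hc ε hε
    exact ⟨p i j ω, hω i j, by rwa [dist_comm]⟩
  rw [hcl.closure_eq] at this
  exact this

lemma ocp_nec_V {Ω : Type} {mΩ : MeasurableSpace Ω} (P : Measure Ω) [IsProbabilityMeasure P]
    {T d : ℕ} (ℱ : Fin (T+1) → MeasurableSpace Ω) (C : Fin (T+1) → Ω → Set (Fin d → ℝ))
    (V : Fin (T+1) → (Fin d → ℝ) → Ω → EReal) (M : OcpMkt mΩ ℱ C V)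
    (x : (Ω → Fin (T+1) → Fin d → ℝ) × (Ω → Fin (T+1) → Fin d → ℝ)) (hx : x ∈ NOCP d ℱ)
    (u Y : Ω → Fin (T+1) → Fin d → ℝ)
    (hYi : ∀ t, Integrable (fun ω => Y ω t) P)
    (hYm : ∀ t, Measurable[ℱ t] (fun ω => Y ω t))
    (hp : OcpPert P ℱ C V x u Y) (hf : OcpFeas P C V x u)
    (t : Fin (T+1)) :
    ∀ᵐ ω ∂P, ∀ v : Fin d → ℝ,
      (((V t (-(x.2 ω t)) ω).toReal + dotd (v + x.2 ω t) (Y ω t) : ℝ) : EReal) ≤ V t v ω := by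
  have key : ∀ q : Fin d → ℚ, ∀ᵐ ω ∂P,
      (((V t (-(x.2 ω t)) ω).toReal + dotd ((fun i => (q i : ℝ)) + x.2 ω t) (Y ω t) : ℝ) : EReal)
        ≤ V t (fun i => (q i : ℝ)) ω := by
    intro q
    set v : Fin d → ℝ := fun i => (q i : ℝ) with hv
    have hVq : Measurable[ℱ t] (fun ω => V t v ω) :=
      ocp_Vmeas le_rfl (V t) (M.V_meas t) (fun _ => v) measurable_const
    have hVk : Measurable[ℱ t] (fun ω => V t (-(x.2 ω t)) ω) :=
      ocp_Vmeas le_rfl (V t) (M.V_meas t) _ (hx.2 t).neg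
    have h := ocp_nec_core P ℱ C V M x hx u Y hYi hYm hp hf t
      (fun ω => v + x.2 ω t) (fun ω => -(v + x.2 ω t))
      (measurable_const.add (hx.2 t)) (measurable_const.add (hx.2 t)).neg
      (fun ω => (V t v ω).toReal - (V t (-(x.2 ω t)) ω).toReal)
      (hVq.ereal_toReal.sub hVk.ereal_toReal) {ω | V t v ω ≠ ⊤}
      (hVq (measurableSet_singleton ⊤).compl)
      (by
        filter_upwards [hf] with ω h0 _
        rw [neg_add_cancel, add_zero]; exact h0.1 t)
      (Filter.Eventually.of_forall (fun ω hω => by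
        have e : -(x.2 ω t + -(v + x.2 ω t)) = v := by abel
        rw [e, add_sub_cancel, EReal.coe_toReal hω (M.V_proper t ω v)]))
    filter_upwards [h] with ω h
    by_cases hω : V t v ω = ⊤
    · rw [hω]; exact le_top
    · have := h hω
      rw [← EReal.coe_toReal hω (M.V_proper t ω v), EReal.coe_le_coe_iff]
      linarith
  filter_upwards [ae_all_iff.2 key] with ω hω v
  by_cases hv : V t v ω = ⊤
  · rw [hv]; exact le_top
  rw [← EReal.coe_toReal hv (M.V_proper t ω v), EReal.coe_le_coe_iff]
  have hq : ∀ n : ℕ, ∃ q : Fin d → ℚ, ∀ i, v i - 1 / ((n:ℝ) + 1) < q i ∧ (q i : ℝ) < v i := by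
    intro n
    have : ∀ i, ∃ q : ℚ, v i - 1 / ((n:ℝ) + 1) < q ∧ (q : ℝ) < v i := fun i =>
      exists_rat_btwn (by have : (0:ℝ) < 1 / ((n:ℝ) + 1) := by positivity
                          linarith)
    choose q hq using this
    exact ⟨q, hq⟩
  choose q hq using hq
  have hlim : Filter.Tendsto (fun n => (fun i => (q n i : ℝ))) Filter.atTop (nhds v) := by
    rw [tendsto_pi_nhds]
    intro i
    have h0 : Filter.Tendsto (fun n : ℕ => v i - 1 / ((n:ℝ) + 1)) Filter.atTop (nhds (v i)) := by
      simpa using tendsto_const_nhds.sub (tendsto_one_div_add_atTop_nhds_zero_nat (𝕜 := ℝ))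
    exact tendsto_of_tendsto_of_tendsto_of_le_of_le h0 tendsto_const_nhds
      (fun n => (hq n i).1.le) (fun n => (hq n i).2.le)
  have hc : Continuous (fun w : Fin d → ℝ =>
      (V t (-(x.2 ω t)) ω).toReal + dotd (w + x.2 ω t) (Y ω t)) :=
    continuous_const.add ((ocp_dotd_cont _).comp (continuous_id.add continuous_const))
  refine le_of_tendsto ((hc.tendsto v).comp hlim) (Filter.Eventually.of_forall (fun n => ?_))
  have h1 := (hω (q n)).trans (M.V_mono t ω _ v (fun i => (hq n i).2.le))
  rw [← EReal.coe_toReal hv (M.V_proper t ω v), EReal.coe_le_coe_iff] at h1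
  exact h1

lemma ocp_nec_sub {Ω : Type} {T d : ℕ} (C : Fin (T+1) → Ω → Set (Fin d → ℝ))
    (V : Fin (T+1) → (Fin d → ℝ) → Ω → EReal) (t : Fin (T+1)) (ω : Ω) (k c y : Fin d → ℝ)
    (hk : V t (-k) ω = (((V t (-k) ω).toReal : ℝ) : EReal))
    (hV : ∀ v : Fin d → ℝ, (((V t (-k) ω).toReal + dotd (v + k) y : ℝ) : EReal) ≤ V t v ω)
    (hc : c ∈ C t ω) (hC : ∀ c' ∈ C t ω, dotd c' y ≤ dotd c y) (y' : Fin d → ℝ) :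
    VconjOCP V t y ω + ((dotd (-k) (y' - y) : ℝ) : EReal) ≤ VconjOCP V t y' ω ∧
    sigmaC C t ω y + ((dotd c (y' - y) : ℝ) : EReal) ≤ sigmaC C t ω y' := by
  constructor
  · have h1 : VconjOCP V t y ω ≤ ((dotd (-k) y - (V t (-k) ω).toReal : ℝ) : EReal) := by
      unfold VconjOCP
      refine iSup_le (fun v => ?_)
      refine (EReal.sub_le_sub le_rfl (hV v)).trans ?_
      rw [← EReal.coe_sub, EReal.coe_le_coe_iff, ocp_dotd_add_left, ocp_dotd_neg_left]
      linarith
    have h2 : ((dotd (-k) y' - (V t (-k) ω).toReal : ℝ) : EReal) ≤ VconjOCP V t y' ω := by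
      unfold VconjOCP
      refine le_trans ?_ (le_iSup _ (-k))
      rw [hk, EReal.toReal_coe, EReal.coe_sub]
    refine (add_le_add_left h1 _).trans (le_trans ?_ h2)
    rw [← EReal.coe_add, EReal.coe_le_coe_iff, ocp_dotd_sub_right]
    linarith
  · have h1 : sigmaC C t ω y ≤ ((dotd c y : ℝ) : EReal) := by
      unfold sigmaC
      exact iSup₂_le (fun a ha => EReal.coe_le_coe_iff.2 (hC a ha))
    have h2 : ((dotd c y' : ℝ) : EReal) ≤ sigmaC C t ω y' := by
      unfold sigmaC
      exact le_iSup₂ (f := fun a (_ : a ∈ C t ω) => ((dotd a y' : ℝ) : EReal)) c hc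
    refine (add_le_add_left h1 _).trans (le_trans ?_ h2)
    rw [← EReal.coe_add, EReal.coe_le_coe_iff, ocp_dotd_sub_right]
    linarith

/-- optimality conditions for the currency market model (OCP) in terms of
martingale consistent price systems. -/
theorem stmt_16
    {Ω : Type} {mΩ : MeasurableSpace Ω} (P : Measure Ω) [IsProbabilityMeasure P]
    {T d : ℕ} (ℱ : Fin (T+1) → MeasurableSpace Ω)
    (hℱ_le : ∀ t, ℱ t ≤ mΩ) (hℱ_mono : Monotone ℱ)
    -- the `𝓕_t`-measurable closed convex-valued mappings `C_t` with `0 ∈ C_t`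
    (C : Fin (T+1) → Ω → Set (Fin d → ℝ))
    (hC_meas : ∀ t, ∀ O : Set (Fin d → ℝ), IsOpen O →
      MeasurableSet[ℱ t] {ω | (C t ω ∩ O).Nonempty})
    (hC_closed : ∀ t ω, IsClosed (C t ω)) (hC_convex : ∀ t ω, Convex ℝ (C t ω))
    (hC_zero : ∀ t ω, (0 : Fin d → ℝ) ∈ C t ω)
    -- the `B(ℝ^d)⊗𝓕_t`-measurable convex normal integrands `V_t`, nondecreasing, `V_t(0)=0`
    (V : Fin (T+1) → (Fin d → ℝ) → Ω → EReal)
    (hV_meas : ∀ t, @Measurable ((Fin d → ℝ) × Ω) EReal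
      (MeasurableSpace.prod inferInstance (ℱ t)) _ (fun p => V t p.1 p.2))
    (hV_proper : ∀ t ω, ∀ c, V t c ω ≠ ⊥)
    (hV_lsc : ∀ t ω, LowerSemicontinuous (fun c => V t c ω))
    (hV_convex : ∀ (t : Fin (T+1)) (ω : Ω) (a b : ℝ) (c₁ c₂ : Fin d → ℝ),
      0 < a → 0 < b → a + b = 1 →
      V t (a • c₁ + b • c₂) ω ≤ (a : EReal) * V t c₁ ω + (b : EReal) * V t c₂ ω)
    (hV_mono : ∀ t ω (c c' : Fin d → ℝ), (∀ i, c i ≤ c' i) → V t c ω ≤ V t c' ω)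
    (hV_zero : ∀ t ω, V t 0 ω = 0)
    -- `𝓤` and `𝓨` are decomposable subspaces in separating duality
    (𝓤 𝓨 : Submodule ℝ (Ω → Fin (T+1) → Fin d → ℝ))
    (h𝓤meas : ∀ u ∈ 𝓤, Measurable u) (h𝓨meas : ∀ y ∈ 𝓨, Measurable y)
    (h𝓤dec : DecomposableB P (𝓤 : Set (Ω → Fin (T+1) → Fin d → ℝ)))
    (h𝓨dec : DecomposableB P (𝓨 : Set (Ω → Fin (T+1) → Fin d → ℝ)))
    (hpair : ∀ u ∈ 𝓤, ∀ y ∈ 𝓨, Integrable (fun ω => dotB (u ω) (y ω)) P)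
    (hsep𝓤 : ∀ u ∈ 𝓤, (∀ y ∈ 𝓨, pairB P u y = 0) → u =ᵐ[P] (fun _ => 0))
    (hsep𝓨 : ∀ y ∈ 𝓨, (∀ u ∈ 𝓤, pairB P u y = 0) → y =ᵐ[P] (fun _ => 0))
    -- adapted projections of elements of `𝓤` and `𝓨` remain in `𝓤` and `𝓨`
    (hproj𝓤 : ∀ u ∈ 𝓤, aProj P ℱ u ∈ 𝓤)
    (hproj𝓨 : ∀ y ∈ 𝓨, aProj P ℱ y ∈ 𝓨)
    -- `𝓤` carries a barreled locally convex topology compatible with the pairing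
    (τ : TopologicalSpace ↥𝓤)
    (hτ_grp : @IsTopologicalAddGroup ↥𝓤 τ _)
    (hτ_smul : @ContinuousSMul ℝ ↥𝓤 _ _ τ)
    (hτ_lcs : @LocallyConvexSpace ℝ ↥𝓤 _ _ _ _ τ)
    (hτ_barrel : ∀ S : Set ↥𝓤, @IsClosed ↥𝓤 τ S → Convex ℝ S → Absorbent ℝ S →
      S ∈ @nhds ↥𝓤 τ 0)
    (hτ_compat : ∀ g : ↥𝓤 →ₗ[ℝ] ℝ, (@Continuous ↥𝓤 ℝ τ _ g) ↔
      ∃ y ∈ 𝓨, ∀ u : ↥𝓤, g u = pairB P (u : Ω → Fin (T+1) → Fin d → ℝ) y)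
    -- the parameterized objective is closed in `u` and the value function is proper
    (hclosed : ∀ x ∈ NOCP d ℱ,
      ClosedFnB P (𝓤 : Set (Ω → Fin (T+1) → Fin d → ℝ))
        (𝓨 : Set (Ω → Fin (T+1) → Fin d → ℝ)) (fun u => intOCP P C V x u))
    (hφ_proper : (∀ u ∈ 𝓤, phiOCP P C V ℱ u ≠ ⊥) ∧ ∃ u ∈ 𝓤, phiOCP P C V ℱ u ≠ ⊤)
    -- `θ` is a convex normal integrand with `Eθ` finite on `𝓤`, `Eθ*` proper on `𝓨`,
    -- and `V_T(Σ_t u_t, ω) ≤ θ(u,ω)`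
    (θ : (Fin (T+1) → Fin d → ℝ) → Ω → EReal)
    (hθ_meas : Measurable (fun p : (Fin (T+1) → Fin d → ℝ) × Ω => θ p.1 p.2))
    (hθ_proper : ∀ ω, (∀ z, θ z ω ≠ ⊥) ∧ ∃ z, θ z ω ≠ ⊤)
    (hθ_lsc : ∀ ω, LowerSemicontinuous (fun z => θ z ω))
    (hθ_convex : ∀ (ω : Ω) (a b : ℝ) (z₁ z₂ : Fin (T+1) → Fin d → ℝ),
      0 < a → 0 < b → a + b = 1 →
      θ (a • z₁ + b • z₂) ω ≤ (a : EReal) * θ z₁ ω + (b : EReal) * θ z₂ ω)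
    (hEθ_fin : ∀ u ∈ 𝓤, ∃ r : ℝ, EE P (fun ω => θ (u ω) ω) = (r : EReal))
    (hEθs_proper :
      (∀ y ∈ 𝓨, EE P (fun ω =>
        ⨆ z : Fin (T+1) → Fin d → ℝ, (((dotB z (y ω) : ℝ) : EReal) - θ z ω)) ≠ ⊥) ∧
      ∃ y ∈ 𝓨, EE P (fun ω =>
        ⨆ z : Fin (T+1) → Fin d → ℝ, (((dotB z (y ω) : ℝ) : EReal) - θ z ω)) ≠ ⊤)
    (hθ_bound : ∀ (u : Fin (T+1) → Fin d → ℝ) (ω : Ω),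
      V (Fin.last T) (∑ t, u t) ω ≤ θ u ω)
    -- the given adapted parameter `u ∈ 𝓤∩𝓝`
    (u : Ω → Fin (T+1) → Fin d → ℝ) (hu : u ∈ 𝓤)
    (hu_adapted : ∀ t, Measurable[ℱ t] (fun ω => u ω t)) :
    ∀ x ∈ NOCP d ℱ,
      -- `(z,k)` solves (OCP)
      ((((∀ t, ∀ᵐ ω ∂P, deltaX (x.1 ω) t + u ω t + x.2 ω t ∈ C t ω) ∧
          (∀ᵐ ω ∂P, x.1 ω (Fin.last T) = 0) ∧
          EE P (fun ω => ∑ t, V t (-(x.2 ω t)) ω) < ⊤) ∧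
        intOCP P C V x u = phiOCP P C V ℱ u) ↔
        -- iff `(z,k)` is feasible and there is a martingale `y ∈ 𝓨` with the stated
        -- subdifferential conditions
        (((∀ t, ∀ᵐ ω ∂P, deltaX (x.1 ω) t + u ω t + x.2 ω t ∈ C t ω) ∧
          (∀ᵐ ω ∂P, x.1 ω (Fin.last T) = 0) ∧
          EE P (fun ω => ∑ t, V t (-(x.2 ω t)) ω) < ⊤) ∧
          ∃ y, y ∈ 𝓨 ∧ (∀ t, Measurable[ℱ t] (fun ω => y ω t)) ∧
            (∀ t, Integrable (fun ω => y ω t) P) ∧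
            -- the martingale property `E[y_{t+1}|𝓕_t] = y_t`
            (∀ t : Fin (T+1), ∀ ht : (t : ℕ) < T, ∀ A : Set Ω, MeasurableSet[ℱ t] A →
              ∫ ω in A, y ω ⟨(t : ℕ) + 1, Nat.succ_lt_succ ht⟩ ∂P =
                ∫ ω in A, y ω t ∂P) ∧
            (∀ t, ∀ᵐ ω ∂P,
              -- `−k_t ∈ ∂V_t*(y_t)`
              (∀ y' : Fin d → ℝ,
                VconjOCP V t (y ω t) ω +
                  ((dotd (-(x.2 ω t)) (y' - y ω t) : ℝ) : EReal) ≤ VconjOCP V t y' ω) ∧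
              -- `Δz_t + u_t + k_t ∈ ∂σ_{C_t}(y_t)`
              (∀ y' : Fin d → ℝ,
                sigmaC C t ω (y ω t) +
                  ((dotd (deltaX (x.1 ω) t + u ω t + x.2 ω t) (y' - y ω t) : ℝ) : EReal) ≤
                  sigmaC C t ω y')))) := by
  have M : OcpMkt mΩ ℱ C V := ⟨hℱ_le, hℱ_mono, hC_meas, hC_closed, hC_convex, hC_zero, hV_meas,
    hV_proper, hV_lsc, hV_convex, hV_mono, hV_zero⟩
  have hum := h𝓤meas u hu
  intro x hx
  refine and_congr_right (fun hfeas => ?_)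
  obtain ⟨hf1, hf2, hf3⟩ := hfeas
  have hnb : ∀ x' ∈ NOCP d ℱ, intOCP P C V x' u ≠ ⊥ := by
    intro x' hx' h
    have h1 : phiOCP P C V ℱ u ≤ intOCP P C V x' u := iInf₂_le x' hx'
    rw [h] at h1
    exact hφ_proper.1 u hu (le_bot_iff.1 h1)
  have hnt : intOCP P C V x u ≠ ⊤ := by
    have e : intOCP P C V x u = EE P (fun ω => ∑ t, V t (-(x.2 ω t)) ω) := by
      refine ocp_EE_congr P _ _ ?_
      filter_upwards [ae_all_iff.2 hf1, hf2] with ω h1 h2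
      exact ocp_f_of C V (x.1 ω) (x.2 ω) (u ω) ω h1 h2
    rw [e]; exact hf3.ne
  constructor
  · intro hopt
    obtain ⟨Y, hY, hYm, hYi, r, hr, hYd⟩ := ocp_dual P ℱ C V M 𝓤 𝓨 h𝓤meas h𝓤dec h𝓨dec hpair
      hproj𝓤 hproj𝓨 τ hτ_grp hτ_smul hτ_barrel hτ_compat hφ_proper.1 θ hEθ_fin hθ_bound u hu
      hu_adapted
    obtain ⟨hp, hf⟩ := ocp_pert P ℱ C V M x hx u Y hum r (hopt.trans hr) hYd
    refine ⟨Y, hY, hYm, hYi,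
      fun t ht A hA => ocp_nec_mart P ℱ C V M x hx u Y hYi hp hf t ht A hA, fun t => ?_⟩
    filter_upwards [hf, ocp_nec_V P ℱ C V M x hx u Y hYi hYm hp hf t,
      ocp_nec_C P ℱ C V M x hx u Y hu_adapted hYi hYm hp hf t] with ω h1 h2 h3
    have h4 := ocp_nec_sub C V t ω (x.2 ω t) (deltaX (x.1 ω) t + u ω t + x.2 ω t) (Y ω t)
      (h1.2.2 t) h2 (h1.1 t) h3
    exact ⟨fun y' => (h4 y').1, fun y' => (h4 y').2⟩
  · rintro ⟨y, hy, hym, hyi, hmart, hsub⟩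
    refine le_antisymm (le_iInf₂ (fun x' hx' => ?_)) (iInf₂_le x hx)
    exact ocp_suff P ℱ C V M u hum x x' hx hx' (hnb x hx) (hnb x' hx') hnt y hyi hmart hsub
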